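/- arXiv:2312.06044 — 7 statements merged into one kernel-verified Lean document; each statement's English description precedes it below -/
import Mathlib

section
/- Let d ≥ 1 be an integer and let r, δ ∈ ℝ satisfy δ > 1 and d > 1 + δ − 2r. Then for every R > 0 the integral ∫_{B(0,R)} |ξ|^{2r} / (ξ₁² + |ξ|^{2δ}) dξ is finite, where B(0,R) is the open Euclidean ball of radius R in ℝ^d and ξ₁ is the first coordinate of ξ. -/
open MeasureTheory

/-- The truncated power `|x| ^ (-c)` with `c < 1` is integrable on the line. -/
lemma integrable_indicator_abs_rpow_neg {c : ℝ} (hc : c < 1) (R : ℝ) :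
    Integrable ((Set.Ioo (-R) R).indicator fun x : ℝ => |x| ^ (-c)) := by
  rw [integrable_indicator_iff measurableSet_Ioo]
  rcases le_total R (-R) with hR | hR
  · simp [Set.Ioo_eq_empty_of_le hR]
  have h : IntervalIntegrable (fun x : ℝ => |x| ^ (-c)) volume (-R) R := by
    refine intervalIntegrable_of_even (fun x => by simp) fun x hx => ?_
    refine (intervalIntegral.intervalIntegrable_rpow' (by linarith : -1 < -c)).congr ?_
    intro y hy
    rw [Set.uIoc_of_le hx.le] at hy
    simp only [abs_of_pos hy.1]
  exact ((intervalIntegrable_iff_integrableOn_Ioc_of_le hR).1 h).mono_set Set.Ioo_subset_Ioc_self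

/-- The product of truncated powers of the coordinates is integrable on Euclidean space. -/
lemma integrable_prod_indicator_abs_rpow_neg {ι : Type*} [Fintype ι] {c : ℝ} (hc : c < 1) (R : ℝ) :
    Integrable fun ξ : EuclideanSpace ℝ ι =>
      ∏ i, (Set.Ioo (-R) R).indicator (fun x : ℝ => |x| ^ (-c)) (ξ i) :=
  (PiLp.volume_preserving_ofLp ι).integrable_comp_of_integrable
    (Integrable.fintype_prod fun _ : ι => integrable_indicator_abs_rpow_neg hc R)

lemma ae_forall_coord_ne_zero (ι : Type*) [Fintype ι] :
    ∀ᵐ ξ : EuclideanSpace ℝ ι, ∀ i, ξ i ≠ 0 :=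
  (PiLp.volume_preserving_ofLp ι).quasiMeasurePreserving.ae <|
    ae_all_iff.2 fun i => Measure.ae_eval_ne (μ := fun _ : ι => (volume : Measure ℝ)) i 0

/-- Young's inequality bounds an anisotropic symbol by a product of powers. -/
lemma rpow_div_sq_add_rpow_le {a N c r δ : ℝ} (ha : a ≠ 0) (hN : 0 < N) (hc₀ : 0 ≤ c)
    (hc₁ : c ≤ 1) :
    N ^ (2 * r) / (a ^ 2 + N ^ (2 * δ)) ≤ |a| ^ (-c) * N ^ (2 * r - δ * (2 - c)) := by
  have ha' : 0 < |a| := abs_pos.2 ha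
  have hNδ : 0 < N ^ (2 * δ) := Real.rpow_pos_of_pos hN _
  have hsq : (a ^ 2) ^ (c / 2) = |a| ^ c := by
    rw [← sq_abs, ← Real.rpow_natCast, ← Real.rpow_mul ha'.le]
    congr 1
    push_cast
    ring
  have hpow : (N ^ (2 * δ)) ^ (1 - c / 2) = N ^ (δ * (2 - c)) := by
    rw [← Real.rpow_mul hN.le]
    congr 1
    ring
  have hyoung : |a| ^ c * N ^ (δ * (2 - c)) ≤ a ^ 2 + N ^ (2 * δ) := by
    have h := Real.geom_mean_le_arith_mean2_weighted (w₁ := c / 2) (w₂ := 1 - c / 2)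
      (by linarith) (by linarith) (sq_nonneg a) hNδ.le (by ring)
    rw [hsq, hpow] at h
    nlinarith [sq_nonneg a]
  calc N ^ (2 * r) / (a ^ 2 + N ^ (2 * δ))
      ≤ N ^ (2 * r) / (|a| ^ c * N ^ (δ * (2 - c))) := by gcongr
    _ = |a| ^ (-c) * N ^ (2 * r - δ * (2 - c)) := by
      rw [Real.rpow_neg ha'.le, Real.rpow_sub hN]
      field_simp

/-- Off the coordinate hyperplanes, the norm power `‖ξ‖ ^ (-c * (n - 1))` times `|ξ i₀| ^ (-c)` is
at most the product of all `|ξ i| ^ (-c)`. -/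
lemma abs_rpow_neg_mul_norm_rpow_le_prod {ι : Type*} [Fintype ι] {c : ℝ} (hc : 0 ≤ c)
    {ξ : EuclideanSpace ℝ ι} (hξ : ∀ i, ξ i ≠ 0) (i₀ : ι) :
    |ξ i₀| ^ (-c) * ‖ξ‖ ^ (-c * ((Fintype.card ι : ℝ) - 1)) ≤ ∏ i, |ξ i| ^ (-c) := by
  classical
  have hcard : ((Finset.univ.erase i₀).card : ℝ) = (Fintype.card ι : ℝ) - 1 := by
    rw [Finset.card_erase_of_mem (Finset.mem_univ _), Finset.card_univ,
      Nat.cast_pred (Fintype.card_pos_iff.2 ⟨i₀⟩)]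
  rw [← Finset.mul_prod_erase _ _ (Finset.mem_univ i₀), ← hcard, Real.rpow_mul (norm_nonneg _),
    Real.rpow_natCast, ← Finset.prod_const]
  refine mul_le_mul_of_nonneg_left (Finset.prod_le_prod (fun _ _ => by positivity) fun i _ => ?_)
    (by positivity)
  exact Real.rpow_le_rpow_of_nonpos (abs_pos.2 (hξ i)) (PiLp.norm_apply_le ξ i)
    (neg_nonpos.2 hc)

theorem stmt0 (d : ℕ) (hd : 0 < d) (r δ : ℝ) (hδ : 1 < δ)
    (hdim : 1 + δ - 2 * r < (d : ℝ)) (R : ℝ) (hR : 0 < R) :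
    (∫⁻ ξ in Metric.ball (0 : EuclideanSpace ℝ (Fin d)) R,
      ENNReal.ofReal (‖ξ‖ ^ (2 * r) / ((ξ ⟨0, hd⟩) ^ 2 + ‖ξ‖ ^ (2 * δ)))) < ⊤ := by
  have hd₁ : (1 : ℝ) ≤ d := by exact_mod_cast hd
  have hpos : 0 < (d : ℝ) - 1 + δ := by linarith
  obtain ⟨c, hc₀, hc₁, hc⟩ : ∃ c : ℝ, 0 ≤ c ∧ c < 1 ∧ 2 * δ - 2 * r ≤ c * ((d : ℝ) - 1 + δ) :=
    ⟨max 0 ((2 * δ - 2 * r) / ((d : ℝ) - 1 + δ)), le_max_left _ _,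
      max_lt one_pos ((div_lt_one hpos).2 (by linarith)),
      (div_le_iff₀ hpos).1 (le_max_right _ _)⟩
  set e : ℝ := 2 * r - δ * (2 - c) + c * ((d : ℝ) - 1) with he
  have he₀ : 0 ≤ e := by rw [he]; linarith
  refine lt_of_le_of_lt (setLIntegral_mono_ae' measurableSet_ball ?_) <|
    ((integrable_prod_indicator_abs_rpow_neg (ι := Fin d) hc₁ R).const_mul
      (R ^ e)).restrict.lintegral_lt_top
  filter_upwards [ae_forall_coord_ne_zero (Fin d)] with ξ hξ hball
  refine ENNReal.ofReal_le_ofReal ?_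
  have hlt : ‖ξ‖ < R := by simpa using hball
  have hN : 0 < ‖ξ‖ := (abs_pos.2 (hξ ⟨0, hd⟩)).trans_le (PiLp.norm_apply_le ξ _)
  have hind : ∏ i, (Set.Ioo (-R) R).indicator (fun x : ℝ => |x| ^ (-c)) (ξ i)
      = ∏ i, |ξ i| ^ (-c) :=
    Finset.prod_congr rfl fun i _ => Set.indicator_of_mem
      (Set.mem_Ioo.2 (abs_lt.1 ((PiLp.norm_apply_le ξ i).trans_lt hlt))) _
  rw [hind]
  calc ‖ξ‖ ^ (2 * r) / ((ξ ⟨0, hd⟩) ^ 2 + ‖ξ‖ ^ (2 * δ))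
      ≤ |ξ ⟨0, hd⟩| ^ (-c) * ‖ξ‖ ^ (2 * r - δ * (2 - c)) :=
        rpow_div_sq_add_rpow_le (hξ _) hN hc₀ hc₁.le
    _ = ‖ξ‖ ^ e * (|ξ ⟨0, hd⟩| ^ (-c) * ‖ξ‖ ^ (-c * ((Fintype.card (Fin d) : ℝ) - 1))) := by
        rw [mul_left_comm, ← Real.rpow_add hN, Fintype.card_fin, he]
        congr 2
        ring
    _ ≤ R ^ e * ∏ i, |ξ i| ^ (-c) := by
        gcongr
        exact abs_rpow_neg_mul_norm_rpow_le_prod hc₀ hξ _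
end

section
/- Let d ≥ 2 be an integer and let s, r, δ ∈ ℝ with δ > 1. Suppose there exists a constant C > 0 such that every measurable g : ℝ^d → [0,∞) satisfies ∫_{B(0,1)} g(ξ) dξ ≤ C (∫_{ℝ^d} ω_{s,r,δ}(ξ) g(ξ)² dξ)^{1/2}. Then d > 1 + δ − 2r. (This is the key step showing that completeness of the anisotropic space X^s_{r,δ} forces d > 1 + δ − 2r.) -/
open MeasureTheory

/-- The anisotropic weight `ω_{s,r,δ}`. -/
noncomputable def omegaW (d : ℕ) (hd : 0 < d) (s r δ : ℝ)
    (ξ : EuclideanSpace ℝ (Fin d)) : ENNReal :=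
  if ‖ξ‖ < 1 then ENNReal.ofReal ((|ξ ⟨0, hd⟩| ^ 2 + ‖ξ‖ ^ (2 * δ)) / ‖ξ‖ ^ (2 * r))
  else ENNReal.ofReal ((1 + ‖ξ‖ ^ 2) ^ s)

/-- An `L¹`-`L²` weighted bound fails on a sequence of disjoint sets along which the weight is at
most a multiple of `1 / a k` while the masses `a k * μ (B k)` stay bounded below. -/
theorem false_of_weighted_bound {α : Type*} [MeasurableSpace α] {μ : Measure α} {S : Set α}
    {ω : α → ENNReal} {C K : ℝ}
    (h : ∀ g : α → ℝ, Measurable g → (∀ x, 0 ≤ g x) →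
      (∫⁻ x in S, ENNReal.ofReal (g x) ∂μ) ≤
        ENNReal.ofReal C * (∫⁻ x, ω x * ENNReal.ofReal (g x) ^ 2 ∂μ) ^ (1/2 : ℝ))
    (hC : 0 ≤ C) (hK : 0 ≤ K) {B : ℕ → Set α} {a v : ℕ → ℝ} (ha : ∀ k, 0 ≤ a k)
    (hB : ∀ k, MeasurableSet (B k)) (hdisj : Pairwise (Function.onFun Disjoint B))
    (hS : ∀ k, B k ⊆ S) (hω : ∀ k, ∀ x ∈ B k, ω x * ENNReal.ofReal (a k) ≤ ENNReal.ofReal K)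
    (hv : ∀ k, μ (B k) = ENNReal.ofReal (v k)) (hav : ∀ k, 1 ≤ a k * v k) : False := by
  obtain ⟨N, hN⟩ := exists_nat_gt (C ^ 2 * K)
  set g : α → ℝ := fun x => ∑ k ∈ Finset.range N, (B k).indicator (fun _ => a k) x with hg
  have hnn : ∀ k x, 0 ≤ (B k).indicator (fun _ => a k) x := fun k x =>
    Set.indicator_nonneg (fun _ _ => ha k) x
  have hg0 : ∀ x, 0 ≤ g x := fun x => Finset.sum_nonneg fun k _ => hnn k x
  have hgm : Measurable g :=
    Finset.measurable_fun_sum _ fun k _ => measurable_const.indicator (hB k)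
  set j : ℝ := ∑ k ∈ Finset.range N, a k * v k with hj
  have hNj : (N : ℝ) ≤ j := by
    calc (N : ℝ) = ∑ k ∈ Finset.range N, (1 : ℝ) := by simp
      _ ≤ j := Finset.sum_le_sum fun k _ => hav k
  have hofg : ∀ x, ENNReal.ofReal (g x) =
      ∑ k ∈ Finset.range N, (B k).indicator (fun _ => ENNReal.ofReal (a k)) x := by
    intro x
    rw [hg, ENNReal.ofReal_sum_of_nonneg fun k _ => hnn k x]
    refine Finset.sum_congr rfl fun k _ => ?_
    by_cases hx : x ∈ B k <;> simp [hx]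
  have hsum : ∀ ν : Measure α, (∀ k, ν (B k) = ENNReal.ofReal (v k)) →
      ∫⁻ x, ENNReal.ofReal (g x) ∂ν = ENNReal.ofReal j := by
    intro ν hν
    simp_rw [hofg]
    rw [lintegral_finsetSum _ fun k _ => measurable_const.indicator (hB k),
      hj, ENNReal.ofReal_sum_of_nonneg fun k _ => zero_le_one.trans (hav k)]
    refine Finset.sum_congr rfl fun k _ => ?_
    rw [lintegral_indicator_const (hB k), hν, ENNReal.ofReal_mul (ha k)]
  have hleft := hsum (μ.restrict S) fun k => by
    rw [Measure.restrict_apply (hB k), Set.inter_eq_left.2 (hS k), hv]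
  have hpt : ∀ x, ω x * ENNReal.ofReal (g x) ^ 2 ≤ ENNReal.ofReal K * ENNReal.ofReal (g x) := by
    intro x
    by_cases hx : ∃ k ∈ Finset.range N, x ∈ B k
    · obtain ⟨k, hk, hxk⟩ := hx
      have hgx : g x = a k := by
        rw [hg]
        dsimp only
        rw [Finset.sum_eq_single_of_mem k hk, Set.indicator_of_mem hxk]
        intro i _ hik
        exact Set.indicator_of_notMem (fun hxi => Set.disjoint_left.1 (hdisj hik) hxi hxk) _
      rw [hgx, sq, ← mul_assoc]
      gcongr
      exact hω k x hxk
    · push Not at hx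
      have hgx : g x = 0 := Finset.sum_eq_zero fun k hk =>
        Set.indicator_of_notMem (hx k hk) _
      simp [hgx]
  have hright : ∫⁻ x, ω x * ENNReal.ofReal (g x) ^ 2 ∂μ ≤ ENNReal.ofReal (K * j) := by
    refine (lintegral_mono hpt).trans_eq ?_
    rw [lintegral_const_mul _ hgm.ennreal_ofReal, hsum μ hv, ENNReal.ofReal_mul hK]
  have hj0 : 0 ≤ j := (Nat.cast_nonneg N).trans hNj
  have hmain : ENNReal.ofReal j ≤ ENNReal.ofReal (C * (K * j) ^ (1/2 : ℝ)) := by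
    rw [← hleft, ENNReal.ofReal_mul hC,
      ← ENNReal.ofReal_rpow_of_nonneg (by positivity) (by norm_num)]
    refine (h g hgm hg0).trans ?_
    gcongr
  rw [ENNReal.ofReal_le_ofReal_iff (by positivity), ← Real.sqrt_eq_rpow] at hmain
  have hjpos : 0 < j := lt_of_lt_of_le ((by positivity : 0 ≤ C ^ 2 * K).trans_lt hN) hNj
  have hsq : j * j ≤ C ^ 2 * K * j := by
    calc j * j ≤ (C * √(K * j)) * (C * √(K * j)) := mul_self_le_mul_self hj0 hmain
      _ = C ^ 2 * (√(K * j) * √(K * j)) := by ring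
      _ = C ^ 2 * K * j := by rw [Real.mul_self_sqrt (by positivity)]; ring
  have := le_of_mul_le_mul_right hsq hjpos
  linarith

/-- A power of `x ∈ [t, M t]` is controlled by the same power of `t`, whatever its sign. -/
theorem rpow_le_one_add_rpow_mul {t x M : ℝ} (p : ℝ) (ht : 0 < t) (hM : 0 < M) (htx : t ≤ x)
    (hxM : x ≤ M * t) : x ^ p ≤ (1 + M ^ p) * t ^ p := by
  have h1 : 0 < t ^ p := Real.rpow_pos_of_pos ht p
  have h2 : 0 < M ^ p := Real.rpow_pos_of_pos hM p
  rcases le_total 0 p with hp | hp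
  · have := Real.rpow_le_rpow (ht.le.trans htx) hxM hp
    rw [Real.mul_rpow hM.le ht.le] at this
    linarith
  · have := Real.rpow_le_rpow_of_nonpos ht htx hp
    nlinarith [mul_pos h1 h2]

/-- The box `(0, t^δ] × (t, 2t] × ⋯ × (t, 2t]`. -/
def anisotropicBox (n : ℕ) (δ t : ℝ) : Set (EuclideanSpace ℝ (Fin (n + 1))) :=
  (MeasurableEquiv.toLp 2 (Fin (n + 1) → ℝ)).symm ⁻¹'
    Set.univ.pi (Fin.cons (Set.Ioc 0 (t ^ δ)) fun _ => Set.Ioc t (2 * t))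

theorem mem_anisotropicBox {n : ℕ} {δ t : ℝ} {ξ : EuclideanSpace ℝ (Fin (n + 1))} :
    ξ ∈ anisotropicBox n δ t ↔
      ξ 0 ∈ Set.Ioc 0 (t ^ δ) ∧ ∀ i : Fin n, ξ i.succ ∈ Set.Ioc t (2 * t) := by
  simp only [anisotropicBox, Set.mem_preimage, Set.mem_univ_pi, Fin.forall_fin_succ, Fin.cons_zero,
    Fin.cons_succ]
  rfl

theorem measurableSet_pi_anisotropic (n : ℕ) (δ t : ℝ) :
    MeasurableSet (Set.univ.pi (Fin.cons (Set.Ioc 0 (t ^ δ)) fun _ => Set.Ioc t (2 * t) :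
      Fin (n + 1) → Set ℝ)) := by
  refine MeasurableSet.univ_pi fun i => ?_
  refine Fin.cases ?_ (fun i => ?_) i
  · exact measurableSet_Ioc
  · exact measurableSet_Ioc

theorem measurableSet_anisotropicBox (n : ℕ) (δ t : ℝ) :
    MeasurableSet (anisotropicBox n δ t) :=
  MeasurableEquiv.measurable _ (measurableSet_pi_anisotropic n δ t)

theorem volume_anisotropicBox (n : ℕ) (δ : ℝ) {t : ℝ} (ht : 0 ≤ t) :
    volume (anisotropicBox n δ t) = ENNReal.ofReal (t ^ δ * t ^ n) := by
  rw [anisotropicBox, (EuclideanSpace.volume_preserving_symm_measurableEquiv_toLp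
    (Fin (n + 1))).measure_preimage (measurableSet_pi_anisotropic n δ t).nullMeasurableSet,
    volume_pi_pi, Fin.prod_univ_succ, ENNReal.ofReal_mul (by positivity), ENNReal.ofReal_pow ht]
  simp [Real.volume_Ioc, two_mul]

theorem norm_le_of_mem_anisotropicBox {n : ℕ} {δ t : ℝ} {ξ : EuclideanSpace ℝ (Fin (n + 1))}
    (hδ : 1 ≤ δ) (ht : 0 < t) (ht1 : t ≤ 1) (hξ : ξ ∈ anisotropicBox n δ t) :
    ‖ξ‖ ≤ 2 * (n + 1) * t := by
  rw [mem_anisotropicBox] at hξ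
  have htδ : t ^ δ ≤ t := by
    simpa using Real.rpow_le_rpow_of_exponent_ge ht ht1 hδ
  have hcoord : ∀ i, ‖ξ i‖ ^ 2 ≤ (2 * t) ^ 2 := by
    intro i
    refine pow_le_pow_left₀ (norm_nonneg _) ?_ 2
    rw [Real.norm_eq_abs, abs_le]
    refine Fin.cases ?_ (fun i => ?_) i
    · constructor <;> linarith [hξ.1.1, hξ.1.2]
    · constructor <;> linarith [(hξ.2 i).1, (hξ.2 i).2]
  rw [EuclideanSpace.norm_eq]
  refine Real.sqrt_le_iff.2 ⟨by positivity, (Finset.sum_le_sum fun i _ => hcoord i).trans ?_⟩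
  simp only [Finset.sum_const, Finset.card_univ, Fintype.card_fin, nsmul_eq_mul, Nat.cast_add,
    Nat.cast_one]
  have hn : (0 : ℝ) ≤ n := n.cast_nonneg
  nlinarith [mul_nonneg hn (sq_nonneg t), mul_nonneg (mul_nonneg hn hn) (sq_nonneg t)]

theorem lt_norm_of_mem_anisotropicBox {n : ℕ} {δ t : ℝ} {ξ : EuclideanSpace ℝ (Fin (n + 2))}
    (hξ : ξ ∈ anisotropicBox (n + 1) δ t) : t < ‖ξ‖ :=
  ((mem_anisotropicBox.1 hξ).2 0).1.trans_le
    ((Real.le_norm_self _).trans (PiLp.norm_apply_le ξ _))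

theorem disjoint_anisotropicBox {n : ℕ} {δ t u : ℝ} (h : 2 * u ≤ t) :
    Disjoint (anisotropicBox (n + 1) δ t) (anisotropicBox (n + 1) δ u) := by
  refine Set.disjoint_left.2 fun ξ h1 h2 => ?_
  linarith [((mem_anisotropicBox.1 h1).2 0).1, ((mem_anisotropicBox.1 h2).2 0).2]

theorem omegaW_mul_le_of_mem_anisotropicBox {n : ℕ} {s r δ t : ℝ} (hd : 0 < n + 2)
    {ξ : EuclideanSpace ℝ (Fin (n + 2))} (hδ : 1 ≤ δ) (ht : 0 < t) (ht1 : t ≤ 1)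
    (hξ : ξ ∈ anisotropicBox (n + 1) δ t) (hlt : ‖ξ‖ < 1) :
    omegaW (n + 2) hd s r δ ξ * ENNReal.ofReal (t ^ (2 * r - 2 * δ)) ≤
      ENNReal.ofReal ((1 + (1 + (2 * (n + 2)) ^ (2 * δ))) * (1 + (2 * (n + 2)) ^ (-(2 * r)))) := by
  have hM : (0 : ℝ) < 2 * (n + 2) := by positivity
  have hup : ‖ξ‖ ≤ 2 * (n + 2) * t := by
    refine (norm_le_of_mem_anisotropicBox hδ ht ht1 hξ).trans_eq ?_
    push_cast; ring
  have hlow := (lt_norm_of_mem_anisotropicBox hξ).le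
  have h1 := rpow_le_one_add_rpow_mul (2 * δ) ht hM hlow hup
  have h2 := rpow_le_one_add_rpow_mul (-(2 * r)) ht hM hlow hup
  have hfirst : |ξ ⟨0, hd⟩| ^ 2 ≤ t ^ (2 * δ) := by
    have h0 : ξ ⟨0, hd⟩ ∈ Set.Ioc 0 (t ^ δ) := (mem_anisotropicBox.1 hξ).1
    rw [abs_of_pos h0.1, mul_comm, Real.rpow_mul ht.le, Real.rpow_two]
    exact pow_le_pow_left₀ h0.1.le h0.2 2
  rw [omegaW, if_pos hlt, ← ENNReal.ofReal_mul (by positivity)]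
  refine ENNReal.ofReal_le_ofReal ?_
  rw [div_eq_mul_inv, ← Real.rpow_neg (norm_nonneg _)]
  calc (|ξ ⟨0, hd⟩| ^ 2 + ‖ξ‖ ^ (2 * δ)) * ‖ξ‖ ^ (-(2 * r)) * t ^ (2 * r - 2 * δ)
      ≤ (t ^ (2 * δ) + (1 + (2 * (n + 2)) ^ (2 * δ)) * t ^ (2 * δ)) *
          ((1 + (2 * (n + 2)) ^ (-(2 * r))) * t ^ (-(2 * r))) * t ^ (2 * r - 2 * δ) := by
        gcongr
    _ = (1 + (1 + (2 * (n + 2)) ^ (2 * δ))) * (1 + (2 * (n + 2)) ^ (-(2 * r))) *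
          (t ^ (2 * δ) * t ^ (-(2 * r)) * t ^ (2 * r - 2 * δ)) := by ring
    _ = _ := by
        rw [← Real.rpow_add ht, ← Real.rpow_add ht,
          show 2 * δ + -(2 * r) + (2 * r - 2 * δ) = 0 by ring, Real.rpow_zero, mul_one]

theorem stmt4 (d : ℕ) (hd : 2 ≤ d) (s r δ : ℝ) (hδ : 1 < δ)
    (h : ∃ C : ℝ, 0 < C ∧ ∀ g : EuclideanSpace ℝ (Fin d) → ℝ, Measurable g →
      (∀ ξ, 0 ≤ g ξ) →
      (∫⁻ ξ in Metric.ball (0 : EuclideanSpace ℝ (Fin d)) 1, ENNReal.ofReal (g ξ)) ≤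
      ENNReal.ofReal C *
        (∫⁻ ξ, omegaW d (by omega) s r δ ξ * ENNReal.ofReal (g ξ) ^ 2) ^ (1/2 : ℝ)) :
    1 + δ - 2 * r < (d : ℝ) := by
  obtain ⟨n, rfl⟩ := Nat.exists_eq_add_of_le' hd
  obtain ⟨C, hC, h⟩ := h
  by_contra! hcon
  push_cast at hcon
  set q : ℝ := (4 * ((n : ℝ) + 2))⁻¹ with hq
  have hn : (0 : ℝ) ≤ n := n.cast_nonneg
  have hq0 : 0 < q := by positivity
  have hqM : 4 * ((n : ℝ) + 2) * q = 1 := mul_inv_cancel₀ (by positivity)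
  have hq2 : 2 * q ≤ 1 := by nlinarith
  have hq1 : q ≤ 1 := by linarith
  set t : ℕ → ℝ := fun k => q ^ (k + 1) with ht
  have ht0 : ∀ k, 0 < t k := fun k => pow_pos hq0 _
  have htq : ∀ k, t k ≤ q := fun k => by
    simpa using pow_le_pow_of_le_one hq0.le hq1 (Nat.le_add_left 1 k)
  have ht1 : ∀ k, t k ≤ 1 := fun k => (htq k).trans hq1
  have hnorm : ∀ k, ∀ ξ ∈ anisotropicBox (n + 1) δ (t k), ‖ξ‖ < 1 := by
    intro k ξ hξ
    have := norm_le_of_mem_anisotropicBox hδ.le (ht0 k) (ht1 k) hξ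
    push_cast at this
    nlinarith [htq k]
  have hsep : ∀ k l, k < l → 2 * t l ≤ t k := by
    intro k l hkl
    have h1 : t l ≤ q ^ (k + 2) := pow_le_pow_of_le_one hq0.le hq1 (by omega)
    have h2 : q ^ (k + 2) = t k * q := pow_succ q (k + 1)
    nlinarith [ht0 k]
  refine false_of_weighted_bound h hC.le (by positivity)
    (B := fun k => anisotropicBox (n + 1) δ (t k)) (a := fun k => t k ^ (2 * r - 2 * δ))
    (v := fun k => t k ^ δ * t k ^ (n + 1)) (fun k => Real.rpow_nonneg (ht0 k).le _)
    (fun k => measurableSet_anisotropicBox _ _ _) ?_ ?_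
    (fun k ξ hξ => omegaW_mul_le_of_mem_anisotropicBox _ hδ.le (ht0 k) (ht1 k) hξ (hnorm k ξ hξ))
    (fun k => volume_anisotropicBox _ _ (ht0 k).le) ?_
  · intro k l hkl
    rcases hkl.lt_or_gt with hlt | hlt
    · exact disjoint_anisotropicBox (hsep k l hlt)
    · exact (disjoint_anisotropicBox (hsep l k hlt)).symm
  · intro k ξ hξ
    simpa using hnorm k ξ hξ
  · intro k
    rw [← Real.rpow_natCast (t k) (n + 1), ← Real.rpow_add (ht0 k), ← Real.rpow_add (ht0 k)]
    refine Real.one_le_rpow_of_pos_of_le_one_of_nonpos (ht0 k) (ht1 k) ?_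
    push_cast
    linarith
end

section
/- Let d ≥ 2 be an integer and let s, r, δ ∈ ℝ with δ > 1. Then there exists a constant C > 0 such that every measurable g : ℝ^d → ℂ satisfies ∫_{ℝ^d} ω_{s,r,δ}(ξ) |g(ξ)|² dξ ≤ C ∫_{ℝ^d} (1 + |ξ|²)^s |g(ξ)|² dξ if and only if r ≤ 1. (This expresses that the embedding H^s(ℝ^d) ↪ X^s_{r,δ}(ℝ^d) holds if and only if r ≤ 1.) -/
open MeasureTheory

lemma rpow_one_add_sq_bounds (s x : ℝ) (hx : 0 ≤ x) (hx1 : x < 1) :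
    2 ^ (-|s|) ≤ (1 + x ^ 2) ^ s ∧ (1 + x ^ 2) ^ s ≤ 2 ^ |s| := by
  have h1 : 1 ≤ 1 + x ^ 2 := by nlinarith
  have h2 : 1 + x ^ 2 ≤ 2 := by nlinarith
  have h0 : 0 < 1 + x ^ 2 := by linarith
  constructor
  · calc (2 : ℝ) ^ (-|s|) ≤ (1 + x ^ 2) ^ (-|s|) :=
          Real.rpow_le_rpow_of_nonpos h0 h2 (neg_nonpos.2 (abs_nonneg s))
      _ ≤ (1 + x ^ 2) ^ s := Real.rpow_le_rpow_of_exponent_le h1 (neg_abs_le s)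
  · calc (1 + x ^ 2) ^ s ≤ (1 + x ^ 2) ^ |s| :=
          Real.rpow_le_rpow_of_exponent_le h1 (le_abs_self s)
      _ ≤ 2 ^ |s| := Real.rpow_le_rpow h0.le h2 (abs_nonneg s)

lemma omegaW_le (d : ℕ) (hd : 0 < d) (s r δ : ℝ) (hδ : 1 < δ) (hr : r ≤ 1)
    (ξ : EuclideanSpace ℝ (Fin d)) :
    omegaW d hd s r δ ξ ≤
      ENNReal.ofReal (2 * 2 ^ |s|) * ENNReal.ofReal ((1 + ‖ξ‖ ^ 2) ^ s) := by
  have hC : (1 : ℝ) ≤ 2 ^ |s| := Real.one_le_rpow one_le_two (abs_nonneg s)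
  rw [← ENNReal.ofReal_mul (by positivity), omegaW]
  split_ifs with h
  · apply ENNReal.ofReal_le_ofReal
    have hlow : 2 ≤ 2 * 2 ^ |s| * (1 + ‖ξ‖ ^ 2) ^ s := by
      have hb := (rpow_one_add_sq_bounds s ‖ξ‖ (norm_nonneg ξ) h).1
      have hinv : (2 : ℝ) ^ |s| * 2 ^ (-|s|) = 1 := by
        rw [← Real.rpow_add two_pos]; simp
      nlinarith
    refine le_trans ?_ hlow
    rcases (norm_nonneg ξ).eq_or_lt with h0 | h0
    · have hξ : ξ = 0 := norm_eq_zero.1 h0.symm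
      simp [hξ, Real.zero_rpow (show 2 * δ ≠ 0 by linarith)]
    · rw [div_le_iff₀ (by positivity)]
      have hcoord : |ξ ⟨0, hd⟩| ≤ ‖ξ‖ := PiLp.norm_apply_le ξ _
      have hsq : |ξ ⟨0, hd⟩| ^ 2 ≤ ‖ξ‖ ^ 2 := pow_le_pow_left₀ (abs_nonneg _) hcoord 2
      have hmono {p : ℝ} (q : ℝ) (hq : q ≤ p) : ‖ξ‖ ^ p ≤ ‖ξ‖ ^ q :=
        Real.rpow_le_rpow_of_exponent_ge h0 h.le hq
      have h3 := hmono (p := 2 * δ) (2 * r) (by linarith)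
      have h4 := hmono (p := 2) (2 * r) (by linarith)
      rw [Real.rpow_two] at h4
      linarith
  · apply ENNReal.ofReal_le_ofReal
    have : 0 ≤ (1 + ‖ξ‖ ^ 2) ^ s := by positivity
    nlinarith

lemma exists_lt_div_rpow (r M : ℝ) (hr : 1 < r) :
    ∃ t : ℝ, 0 < t ∧ t < 1 / 2 ∧ M < (t / 2) ^ 2 / (2 * t) ^ (2 * r) := by
  have hT : Filter.Tendsto (fun t : ℝ => t ^ (2 - 2 * r)) (nhdsWithin 0 (Set.Ioi 0))
      Filter.atTop := tendsto_rpow_neg_nhdsGT_zero (by linarith)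
  have hI : Set.Ioo (0 : ℝ) (1 / 2) ∈ nhdsWithin (0 : ℝ) (Set.Ioi 0) :=
    Ioo_mem_nhdsGT (by norm_num)
  obtain ⟨t, ht, ht0, ht1⟩ :=
    ((hT.eventually_gt_atTop (M * (4 * 2 ^ (2 * r)))).and hI).exists
  refine ⟨t, ht0, ht1, ?_⟩
  rw [lt_div_iff₀ (by positivity), Real.mul_rpow two_pos.le ht0.le]
  rw [Real.rpow_sub ht0, Real.rpow_two, lt_div_iff₀ (by positivity)] at ht
  linarith

lemma lt_omegaW_of_mem_ball (d : ℕ) (hd : 0 < d) (s r δ t M : ℝ) (hr : 1 < r) (ht0 : 0 < t)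
    (ht1 : t < 1 / 2) (hM : M < (t / 2) ^ 2 / (2 * t) ^ (2 * r)) (ξ : EuclideanSpace ℝ (Fin d))
    (hξ : ξ ∈ Metric.ball (EuclideanSpace.single (⟨0, hd⟩ : Fin d) t) (t / 2)) :
    ‖ξ‖ < 1 ∧ ENNReal.ofReal M ≤ omegaW d hd s r δ ξ := by
  set e := EuclideanSpace.single (⟨0, hd⟩ : Fin d) t with he
  rw [mem_ball_iff_norm] at hξ
  have hnorm_e : ‖e‖ = t := by simp [he, abs_of_pos ht0]
  have hcoord : |ξ ⟨0, hd⟩ - t| ≤ ‖ξ - e‖ := by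
    simpa [he] using PiLp.norm_apply_le (ξ - e) ⟨0, hd⟩
  have hlow : t / 2 ≤ ξ ⟨0, hd⟩ := by linarith [(abs_le.1 hcoord).1]
  have hle : ξ ⟨0, hd⟩ ≤ ‖ξ‖ := (le_abs_self _).trans (PiLp.norm_apply_le ξ _)
  have hup : ‖ξ‖ < 3 / 2 * t := by linarith [norm_sub_norm_le ξ e]
  have h1 : ‖ξ‖ < 1 := by linarith
  have h0 : 0 < ‖ξ‖ := by linarith
  refine ⟨h1, ?_⟩
  rw [omegaW, if_pos h1]
  apply ENNReal.ofReal_le_ofReal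
  refine hM.le.trans ?_
  have hsq : (t / 2) ^ 2 ≤ |ξ ⟨0, hd⟩| ^ 2 :=
    pow_le_pow_left₀ (by positivity) (hlow.trans (le_abs_self _)) 2
  have hδ : 0 ≤ ‖ξ‖ ^ (2 * δ) := by positivity
  have hpow : ‖ξ‖ ^ (2 * r) ≤ (2 * t) ^ (2 * r) :=
    Real.rpow_le_rpow h0.le (by linarith) (by linarith)
  exact div_le_div₀ (by positivity) (by linarith) (by positivity) hpow

theorem stmt6 (d : ℕ) (hd : 2 ≤ d) (s r δ : ℝ) (hδ : 1 < δ) :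
    (∃ C : ℝ, 0 < C ∧ ∀ g : EuclideanSpace ℝ (Fin d) → ℂ, Measurable g →
      (∫⁻ ξ, omegaW d (by omega) s r δ ξ * (‖g ξ‖₊ : ENNReal) ^ 2) ≤
      ENNReal.ofReal C *
        ∫⁻ ξ, ENNReal.ofReal ((1 + ‖ξ‖ ^ 2) ^ s) * (‖g ξ‖₊ : ENNReal) ^ 2) ↔
    r ≤ 1 := by
  have hd0 : 0 < d := by omega
  constructor
  · rintro ⟨C, hC, H⟩
    by_contra! hr
    obtain ⟨t, ht0, ht1, ht⟩ := exists_lt_div_rpow r (C * 2 ^ |s| + 1) hr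
    set B := Metric.ball (EuclideanSpace.single (⟨0, hd0⟩ : Fin d) t) (t / 2)
    have hB : MeasurableSet B := Metric.isOpen_ball.measurableSet
    have hball := lt_omegaW_of_mem_ball d hd0 s r δ t _ hr ht0 ht1 ht
    have hind (w : EuclideanSpace ℝ (Fin d) → ENNReal) :
        ∫⁻ ξ, w ξ * (‖B.indicator (fun _ => (1 : ℂ)) ξ‖₊ : ENNReal) ^ 2 = ∫⁻ ξ in B, w ξ := by
      rw [← lintegral_indicator hB]
      congr 1 with ξ
      by_cases hξ : ξ ∈ B <;> simp [hξ]
    have key := H (B.indicator fun _ => 1) (measurable_const.indicator hB)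
    rw [hind, hind] at key
    have hlow : ENNReal.ofReal (C * 2 ^ |s| + 1) * volume B ≤
        ∫⁻ ξ in B, omegaW d hd0 s r δ ξ := by
      rw [← setLIntegral_const]
      exact setLIntegral_mono' hB fun ξ hξ => (hball ξ hξ).2
    have hup : ∫⁻ ξ in B, ENNReal.ofReal ((1 + ‖ξ‖ ^ 2) ^ s) ≤
        ENNReal.ofReal (2 ^ |s|) * volume B := by
      rw [← setLIntegral_const]
      exact setLIntegral_mono' hB fun ξ hξ => ENNReal.ofReal_le_ofReal
        (rpow_one_add_sq_bounds s ‖ξ‖ (norm_nonneg ξ) (hball ξ hξ).1).2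
    have hfin := hlow.trans (key.trans (mul_le_mul_right hup _))
    rw [← mul_assoc, ← ENNReal.ofReal_mul hC.le,
      ENNReal.mul_le_mul_iff_left (Metric.measure_ball_pos _ _ (by positivity)).ne'
        measure_ball_lt_top.ne,
      ENNReal.ofReal_le_ofReal_iff (by positivity)] at hfin
    linarith
  · intro hr
    refine ⟨2 * 2 ^ |s|, by positivity, fun g _ => ?_⟩
    rw [← lintegral_const_mul' _ _ ENNReal.ofReal_ne_top]
    refine lintegral_mono fun ξ => ?_
    rw [← mul_assoc]
    gcongr
    exact omegaW_le d hd0 s r δ hδ hr ξ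
end

section
/- Let d ≥ 2 be an integer and let s, r, δ ∈ ℝ satisfy δ > 1, r ≤ 1, and d > 1 + δ − 2r. Let Q be a d×d orthogonal matrix with |Qe₁ · e₁| < 1. Then there exists a measurable function F : ℝ^d → [0,∞), supported in the closed unit ball of ℝ^d, such that ∫_{ℝ^d} F(ξ) dξ < ∞, ∫_{ℝ^d} ω_{s,r,δ}(ξ) F(ξ)² dξ < ∞, ∫_{ℝ^d} F(ξ)² dξ = ∞, and ∫_{ℝ^d} ω_{s,r,δ}(Qᵀξ) F(ξ)² dξ = ∞. (This expresses the anisotropy of X^s_{r,δ}: the inverse Fourier transform f of F lies in X^s_{r,δ} ∩ C⁰_∞ but not in H^s, and f ∘ Q ∉ X^s_{r,δ}.) -/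
open MeasureTheory Matrix

/-- The dyadic scale `4 ^ (-(k + 1))`. -/
noncomputable def dyadicScale (k : ℕ) : ℝ := (1 / 4) ^ (k + 1)

lemma dyadicScale_pos (k : ℕ) : 0 < dyadicScale k := by unfold dyadicScale; positivity

lemma dyadicScale_le (k : ℕ) : dyadicScale k ≤ 1 / 4 := by
  unfold dyadicScale
  exact pow_le_of_le_one (by norm_num) (by norm_num) (by omega)

lemma four_mul_dyadicScale_le {k l : ℕ} (h : k < l) : 4 * dyadicScale l ≤ dyadicScale k := by
  unfold dyadicScale
  rw [pow_succ (1 / 4 : ℝ) l]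
  have : (1 / 4 : ℝ) ^ l ≤ (1 / 4) ^ (k + 1) :=
    pow_le_pow_of_le_one (by norm_num) (by norm_num) h
  linarith

lemma summable_dyadicScale_rpow {q : ℝ} (hq : 0 < q) :
    Summable fun k => dyadicScale k ^ q := by
  have h : (fun k => dyadicScale k ^ q) = fun k => ((1 / 4 : ℝ) ^ q) ^ (k + 1) := by
    funext k
    unfold dyadicScale
    rw [← Real.rpow_natCast, ← Real.rpow_natCast, ← Real.rpow_mul (by norm_num),
      ← Real.rpow_mul (by norm_num), mul_comm]
  rw [h, summable_nat_add_iff (f := fun k => ((1 / 4 : ℝ) ^ q) ^ k) 1]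
  exact summable_geometric_of_lt_one (by positivity)
    (Real.rpow_lt_one (by norm_num) (by norm_num) hq)

lemma rpow_le_of_mem_Icc {ρ x : ℝ} (hρ : 0 < ρ) (h1 : ρ ≤ x) (h2 : x ≤ 3 * ρ) (p : ℝ) :
    x ^ p ≤ 3 ^ |p| * ρ ^ p := by
  rcases le_total 0 p with hp | hp
  · rw [abs_of_nonneg hp, ← Real.mul_rpow (by norm_num) hρ.le]
    exact Real.rpow_le_rpow (hρ.le.trans h1) h2 hp
  · calc x ^ p ≤ ρ ^ p := Real.rpow_le_rpow_of_nonpos hρ h1 hp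
      _ ≤ 3 ^ |p| * ρ ^ p := le_mul_of_one_le_left (by positivity)
        (Real.one_le_rpow (by norm_num) (abs_nonneg p))

lemma le_rpow_of_mem_Icc {ρ x : ℝ} (hρ : 0 < ρ) (h1 : ρ ≤ x) (h2 : x ≤ 3 * ρ) (p : ℝ) :
    3 ^ (-|p|) * ρ ^ p ≤ x ^ p := by
  have hx : 0 < x := hρ.trans_le h1
  have h := rpow_le_of_mem_Icc hρ h1 h2 (-p)
  rw [abs_neg, Real.rpow_neg hx.le, Real.rpow_neg hρ.le] at h
  rw [Real.rpow_neg (by norm_num)]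
  have hxp : 0 < x ^ p := by positivity
  have hρp : 0 < ρ ^ p := by positivity
  have h3 : (0 : ℝ) < 3 ^ |p| := by positivity
  rw [inv_mul_le_iff₀ h3]
  rw [← div_eq_mul_inv, inv_le_comm₀ hxp (by positivity), inv_div, div_le_iff₀ h3] at h
  linarith

/-- Integrals of powers of the norm over a disjoint union of sets `B k` that lie in the annuli
`dyadicScale k ≤ ‖ξ‖ ≤ 3 * dyadicScale k` and have measure `v * dyadicScale k ^ D`. -/
lemma lintegral_norm_rpow_iUnion {E : Type*} [NormedAddCommGroup E] [MeasurableSpace E]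
    {μ : Measure E} {B : ℕ → Set E} (hB : ∀ k, MeasurableSet (B k))
    (hdisj : Pairwise (Function.onFun Disjoint B)) {v D : ℝ} (hv : 0 < v)
    (hvol : ∀ k, μ (B k) = ENNReal.ofReal (v * dyadicScale k ^ D))
    (hnorm : ∀ k, ∀ ξ ∈ B k, dyadicScale k ≤ ‖ξ‖ ∧ ‖ξ‖ ≤ 3 * dyadicScale k) (p : ℝ) :
    (-D < p → ∫⁻ ξ in ⋃ k, B k, ENNReal.ofReal (‖ξ‖ ^ p) ∂μ < ⊤) ∧
    (p ≤ -D → ∫⁻ ξ in ⋃ k, B k, ENNReal.ofReal (‖ξ‖ ^ p) ∂μ = ⊤) := by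
  rw [lintegral_iUnion hB hdisj]
  have key : ∀ (C : ℝ) (k : ℕ), 0 ≤ C →
      ∫⁻ _ in B k, ENNReal.ofReal (C * dyadicScale k ^ p) ∂μ =
        ENNReal.ofReal (C * v * dyadicScale k ^ (p + D)) := by
    intro C k hC
    have hρ := dyadicScale_pos k
    rw [setLIntegral_const, hvol, ← ENNReal.ofReal_mul (by positivity), Real.rpow_add hρ]
    congr 1
    ring
  constructor
  · intro hp
    have hle : ∀ k, ∫⁻ ξ in B k, ENNReal.ofReal (‖ξ‖ ^ p) ∂μ ≤
        ENNReal.ofReal (3 ^ |p| * v * dyadicScale k ^ (p + D)) := by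
      intro k
      rw [← key _ k (by positivity)]
      exact setLIntegral_mono' (hB k) fun ξ hξ => ENNReal.ofReal_le_ofReal
        (rpow_le_of_mem_Icc (dyadicScale_pos k) (hnorm k ξ hξ).1 (hnorm k ξ hξ).2 p)
    refine (ENNReal.tsum_le_tsum hle).trans_lt ?_
    have hs := (summable_dyadicScale_rpow (q := p + D) (by linarith)).mul_left (3 ^ |p| * v)
    exact lt_top_iff_ne_top.2 hs.tsum_ofReal_ne_top
  · intro hp
    have hle : ∀ k, ENNReal.ofReal (3 ^ (-|p|) * v) ≤
        ∫⁻ ξ in B k, ENNReal.ofReal (‖ξ‖ ^ p) ∂μ := by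
      intro k
      have hρ := dyadicScale_pos k
      refine le_trans ?_ (setLIntegral_mono' (hB k) fun ξ hξ => ENNReal.ofReal_le_ofReal
        (le_rpow_of_mem_Icc hρ (hnorm k ξ hξ).1 (hnorm k ξ hξ).2 p))
      rw [key _ k (by positivity)]
      refine ENNReal.ofReal_le_ofReal (le_mul_of_one_le_right (by positivity) ?_)
      exact Real.one_le_rpow_of_pos_of_le_one_of_nonpos hρ
        ((dyadicScale_le k).trans (by norm_num)) (by linarith)
    refine top_unique (le_trans (le_of_eq ?_) (ENNReal.tsum_le_tsum hle))
    refine (ENNReal.tsum_const_eq_top_of_ne_zero ?_).symm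
    have : (0 : ℝ) < 3 ^ (-|p|) * v := by positivity
    simpa using this

/-- A thin box at scale `ρ`: the coordinate `j` lies in `(ρ, 2 * ρ)`, the coordinate `i₀` in
`(0, η * ρ ^ δ)`, and all the others in `(0, η * ρ)`. -/
def thinBox {ι : Type*} [DecidableEq ι] (i₀ j : ι) (η δ ρ : ℝ) : Set (EuclideanSpace ℝ ι) :=
  {ξ | ∀ i, ξ i ∈ Set.Ioo (if i = j then ρ else 0)
    (if i = j then 2 * ρ else if i = i₀ then η * ρ ^ δ else η * ρ)}

section thinBox

variable {ι : Type*} [DecidableEq ι] {i₀ j : ι} {η δ ρ : ℝ}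
  {ξ : EuclideanSpace ℝ ι}

lemma abs_apply_le_of_mem_thinBox (hδ : 1 ≤ δ) (hη : 0 < η) (hρ : 0 < ρ) (hρ1 : ρ ≤ 1)
    (h : ξ ∈ thinBox i₀ j η δ ρ) {i : ι} (hi : i ≠ j) : |ξ i| ≤ η * ρ := by
  have h := h i
  simp only [hi, if_false, Set.mem_Ioo] at h
  rw [abs_of_pos h.1]
  have hle : ρ ^ δ ≤ ρ := by
    simpa using Real.rpow_le_rpow_of_exponent_ge hρ hρ1 hδ
  split_ifs at h
  · exact h.2.le.trans (by gcongr)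
  · exact h.2.le

lemma apply_mem_Ioo_of_mem_thinBox (h : ξ ∈ thinBox i₀ j η δ ρ) : ξ j ∈ Set.Ioo ρ (2 * ρ) := by
  simpa using h j

lemma thinBox_eq_preimage : thinBox i₀ j η δ ρ =
    (MeasurableEquiv.toLp 2 (ι → ℝ)).symm ⁻¹' Set.univ.pi fun i =>
      Set.Ioo (if i = j then ρ else 0)
        (if i = j then 2 * ρ else if i = i₀ then η * ρ ^ δ else η * ρ) := by
  ext ξ
  simp [thinBox]

variable [Fintype ι]

lemma measurableSet_thinBox : MeasurableSet (thinBox i₀ j η δ ρ) := by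
  rw [thinBox_eq_preimage]
  exact (MeasurableEquiv.toLp 2 (ι → ℝ)).symm.measurable
    (MeasurableSet.univ_pi fun _ => measurableSet_Ioo)

lemma volume_thinBox (hj : j ≠ i₀) (hη : 0 < η) (hρ : 0 < ρ) :
    volume (thinBox i₀ j η δ ρ) =
      ENNReal.ofReal (η⁻¹ * η ^ Fintype.card ι * ρ ^ ((Fintype.card ι : ℝ) - 1 + δ)) := by
  rw [thinBox_eq_preimage,
    (EuclideanSpace.volume_preserving_symm_measurableEquiv_toLp ι).measure_preimage_equiv,
    Real.volume_pi_Ioo, ← ENNReal.ofReal_prod_of_nonneg]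
  · congr 1
    have h : ∀ i : ι, (if i = j then 2 * ρ else if i = i₀ then η * ρ ^ δ else η * ρ) -
        (if i = j then ρ else 0) =
        (if i = j then η⁻¹ else 1) * (if i = i₀ then ρ ^ (δ - 1) else 1) * (η * ρ) := by
      intro i
      rcases eq_or_ne i j with rfl | hij
      · simp only [if_true, hj, if_false]
        field_simp
        ring
      · rcases eq_or_ne i i₀ with rfl | hi
        · simp only [hij, if_true, if_false, Real.rpow_sub_one hρ.ne']
          field_simp
          ring
        · simp [hij, hi]
    rw [Finset.prod_congr rfl fun i _ => h i, Finset.prod_mul_distrib, Finset.prod_mul_distrib,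
      Finset.prod_ite_eq', Finset.prod_ite_eq', Finset.prod_const, Finset.card_univ, mul_pow,
      show (Fintype.card ι : ℝ) - 1 + δ = (δ - 1) + (Fintype.card ι : ℝ) by ring,
      Real.rpow_add hρ, Real.rpow_natCast]
    simp only [Finset.mem_univ, if_true]
    ring
  · intro i _
    have : 0 < ρ ^ δ := by positivity
    split_ifs
    · linarith
    · simp; positivity
    · simp; positivity

lemma norm_mem_Icc_of_mem_thinBox (hδ : 1 ≤ δ) (hη : 0 < η) (hη1 : η * Fintype.card ι ≤ 1)
    (hρ : 0 < ρ) (hρ1 : ρ ≤ 1) (h : ξ ∈ thinBox i₀ j η δ ρ) :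
    ρ ≤ ‖ξ‖ ∧ ‖ξ‖ ≤ 3 * ρ := by
  have hj := apply_mem_Ioo_of_mem_thinBox h
  constructor
  · have := PiLp.norm_apply_le ξ j
    rw [Real.norm_eq_abs] at this
    exact hj.1.le.trans ((le_abs_self _).trans this)
  · have hle : ‖ξ‖ ≤ ∑ i, |ξ i| := by
      rw [EuclideanSpace.norm_eq]
      refine Real.sqrt_le_iff.2 ⟨Finset.sum_nonneg fun i _ => abs_nonneg _, ?_⟩
      exact Finset.sum_sq_le_sq_sum_of_nonneg fun i _ => abs_nonneg _
    have hsum : ∑ i ∈ Finset.univ.erase j, |ξ i| ≤ ρ := by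
      calc ∑ i ∈ Finset.univ.erase j, |ξ i| ≤ ∑ i ∈ Finset.univ.erase j, η * ρ :=
            Finset.sum_le_sum fun i hi =>
              abs_apply_le_of_mem_thinBox hδ hη hρ hρ1 h (Finset.ne_of_mem_erase hi)
        _ ≤ ∑ i : ι, η * ρ := Finset.sum_le_sum_of_subset_of_nonneg (Finset.erase_subset _ _)
            fun _ _ _ => by positivity
        _ = (η * Fintype.card ι) * ρ := by simp; ring
        _ ≤ ρ := mul_le_of_le_one_left hρ.le hη1
    rw [← Finset.add_sum_erase _ _ (Finset.mem_univ j),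
      abs_of_pos (hρ.trans hj.1)] at hle
    linarith [hj.2]

lemma le_abs_sum_of_mem_thinBox (hδ : 1 ≤ δ) (hη : 0 < η) (hρ : 0 < ρ) (hρ1 : ρ ≤ 1)
    {w : ι → ℝ} (hηw : η * ∑ i, |w i| ≤ |w j| / 2) (h : ξ ∈ thinBox i₀ j η δ ρ) :
    |w j| / 2 * ρ ≤ |∑ i, w i * ξ i| := by
  have hj := apply_mem_Ioo_of_mem_thinBox h
  have hsum : |∑ i ∈ Finset.univ.erase j, w i * ξ i| ≤ |w j| / 2 * ρ := by
    calc |∑ i ∈ Finset.univ.erase j, w i * ξ i|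
        ≤ ∑ i ∈ Finset.univ.erase j, |w i * ξ i| := Finset.abs_sum_le_sum_abs _ _
      _ ≤ ∑ i ∈ Finset.univ.erase j, |w i| * (η * ρ) := by
          refine Finset.sum_le_sum fun i hi => ?_
          rw [abs_mul]
          gcongr
          exact abs_apply_le_of_mem_thinBox hδ hη hρ hρ1 h (Finset.ne_of_mem_erase hi)
      _ ≤ ∑ i, |w i| * (η * ρ) := Finset.sum_le_sum_of_subset_of_nonneg
          (Finset.erase_subset _ _) fun _ _ _ => by positivity
      _ = (η * ∑ i, |w i|) * ρ := by rw [← Finset.sum_mul]; ring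
      _ ≤ |w j| / 2 * ρ := by gcongr
  have hmain : |w j| * ρ ≤ |w j * ξ j| := by
    rw [abs_mul]
    gcongr
    exact hj.1.le.trans (le_abs_self _)
  rw [← Finset.add_sum_erase _ _ (Finset.mem_univ j)]
  have := abs_sub_abs_le_abs_add (w j * ξ j) (∑ i ∈ Finset.univ.erase j, w i * ξ i)
  linarith

/-- A set thin in the direction `i₀`, accumulating at the origin, along which a linear form
that is not a multiple of the coordinate `i₀` is comparable to the norm. -/
lemma exists_thin_set {i₀ j : ι} (hj : j ≠ i₀) {δ : ℝ} (hδ : 1 ≤ δ) {w : ι → ℝ}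
    (hw : w j ≠ 0) :
    ∃ (S : Set (EuclideanSpace ℝ ι)) (c : ℝ), MeasurableSet S ∧ 0 < c ∧
      (∀ ξ ∈ S, 0 < ‖ξ‖ ∧ ‖ξ‖ < 1 ∧ |ξ i₀| ≤ ‖ξ‖ ^ δ ∧ c * ‖ξ‖ ≤ |∑ i, w i * ξ i|) ∧
      ∀ p : ℝ, (-((Fintype.card ι : ℝ) - 1 + δ) < p →
          ∫⁻ ξ in S, ENNReal.ofReal (‖ξ‖ ^ p) < ⊤) ∧
        (p ≤ -((Fintype.card ι : ℝ) - 1 + δ) →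
          ∫⁻ ξ in S, ENNReal.ofReal (‖ξ‖ ^ p) = ⊤) := by
  have hwj : 0 < |w j| := abs_pos.2 hw
  have hW : 0 < ∑ i, |w i| := hwj.trans_le
    (Finset.single_le_sum (f := fun i => |w i|) (fun i _ => abs_nonneg _) (Finset.mem_univ j))
  have hcard : (1 : ℝ) ≤ Fintype.card ι := by
    exact_mod_cast Fintype.card_pos_iff.2 ⟨j⟩
  obtain ⟨η, hη, hη1, hηw⟩ : ∃ η : ℝ, 0 < η ∧ η * Fintype.card ι ≤ 1 ∧
      η * ∑ i, |w i| ≤ |w j| / 2 := by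
    refine ⟨min (1 / (Fintype.card ι : ℝ)) (|w j| / 2 / ∑ i, |w i|),
      lt_min (by positivity) (by positivity), ?_, ?_⟩
    · rw [← le_div_iff₀ (by positivity)]
      exact min_le_left _ _
    · rw [← le_div_iff₀ hW]
      exact min_le_right _ _
  have hη_le : η ≤ 1 := (le_mul_of_one_le_right hη.le hcard).trans hη1
  have hρ1 : ∀ k, dyadicScale k ≤ 1 := fun k => (dyadicScale_le k).trans (by norm_num)
  have hnorm : ∀ k, ∀ ξ ∈ thinBox i₀ j η δ (dyadicScale k),
      dyadicScale k ≤ ‖ξ‖ ∧ ‖ξ‖ ≤ 3 * dyadicScale k := fun k ξ hξ =>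
    norm_mem_Icc_of_mem_thinBox hδ hη hη1 (dyadicScale_pos k) (hρ1 k) hξ
  refine ⟨⋃ k, thinBox i₀ j η δ (dyadicScale k), |w j| / 6,
    MeasurableSet.iUnion fun k => measurableSet_thinBox, by positivity, ?_,
    lintegral_norm_rpow_iUnion (fun k => measurableSet_thinBox) ?_
      (v := η⁻¹ * η ^ Fintype.card ι) (by positivity)
      (fun k => volume_thinBox hj hη (dyadicScale_pos k)) hnorm⟩
  · intro ξ hξ
    obtain ⟨k, hk⟩ := Set.mem_iUnion.1 hξ
    have hρ := dyadicScale_pos k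
    obtain ⟨h1, h2⟩ := hnorm k ξ hk
    refine ⟨hρ.trans_le h1, by linarith [dyadicScale_le k], ?_, ?_⟩
    · have h0 := hk i₀
      simp only [hj.symm, if_true, if_false, Set.mem_Ioo] at h0
      rw [abs_of_pos h0.1]
      calc ξ i₀ ≤ η * dyadicScale k ^ δ := h0.2.le
        _ ≤ dyadicScale k ^ δ := mul_le_of_le_one_left (by positivity) hη_le
        _ ≤ ‖ξ‖ ^ δ := Real.rpow_le_rpow hρ.le h1 (by linarith)
    · refine le_trans ?_ (le_abs_sum_of_mem_thinBox hδ hη hρ (hρ1 k) hηw hk)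
      nlinarith
  · refine (pairwise_disjoint_on _).2 fun k l hkl => Set.disjoint_left.2 fun ξ hk hl => ?_
    have h1 := apply_mem_Ioo_of_mem_thinBox hk
    have h2 := apply_mem_Ioo_of_mem_thinBox hl
    linarith [h1.1, h2.2, four_mul_dyadicScale_le hkl, dyadicScale_pos l]

end thinBox

lemma norm_toEuclideanLin_transpose {ι : Type*} [Fintype ι] [DecidableEq ι]
    {Q : Matrix ι ι ℝ} (hQ : Qᵀ * Q = 1) (ξ : EuclideanSpace ℝ ι) :
    ‖Matrix.toEuclideanLin Qᵀ ξ‖ = ‖ξ‖ := by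
  have hQ' : Q * Qᵀ = 1 := mul_eq_one_comm.1 hQ
  rw [← sq_eq_sq₀ (norm_nonneg _) (norm_nonneg _), EuclideanSpace.real_norm_sq_eq,
    EuclideanSpace.real_norm_sq_eq]
  have h : (Qᵀ *ᵥ ξ.ofLp) ⬝ᵥ (Qᵀ *ᵥ ξ.ofLp) = ξ.ofLp ⬝ᵥ ξ.ofLp := by
    rw [Matrix.dotProduct_mulVec, Matrix.vecMul_transpose, Matrix.mulVec_mulVec, hQ',
      Matrix.one_mulVec]
  simpa [dotProduct, sq] using h

lemma exists_ne_apply_ne_zero_of_abs_lt_one {ι : Type*} [Fintype ι] [DecidableEq ι]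
    {Q : Matrix ι ι ℝ} (hQ : Qᵀ * Q = 1) {i₀ : ι} (h : |Q i₀ i₀| < 1) :
    ∃ j, j ≠ i₀ ∧ Q j i₀ ≠ 0 := by
  by_contra! hcon
  have h1 := congrFun (congrFun hQ i₀) i₀
  rw [Matrix.mul_apply, Matrix.one_apply_eq, Finset.sum_eq_single i₀
    (fun j _ hj => by simp [hcon j hj]) (by simp), Matrix.transpose_apply] at h1
  have := abs_mul_abs_self (Q i₀ i₀)
  nlinarith [abs_nonneg (Q i₀ i₀)]


theorem stmt7 (d : ℕ) (hd : 2 ≤ d) (s r δ : ℝ) (hδ : 1 < δ) (hr : r ≤ 1)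
    (hdim : 1 + δ - 2 * r < (d : ℝ))
    (Q : Matrix (Fin d) (Fin d) ℝ) (hQ : Qᵀ * Q = 1)
    (hQ11 : |Q ⟨0, by omega⟩ ⟨0, by omega⟩| < 1) :
    ∃ F : EuclideanSpace ℝ (Fin d) → ℝ, Measurable F ∧ (∀ ξ, 0 ≤ F ξ) ∧
      (∀ ξ, ξ ∉ Metric.closedBall (0 : EuclideanSpace ℝ (Fin d)) 1 → F ξ = 0) ∧
      (∫⁻ ξ, ENNReal.ofReal (F ξ)) < ⊤ ∧
      (∫⁻ ξ, omegaW d (by omega) s r δ ξ * ENNReal.ofReal (F ξ) ^ 2) < ⊤ ∧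
      (∫⁻ ξ, ENNReal.ofReal (F ξ) ^ 2) = ⊤ ∧
      (∫⁻ ξ, omegaW d (by omega) s r δ (Matrix.toEuclideanLin Qᵀ ξ) *
        ENNReal.ofReal (F ξ) ^ 2) = ⊤ := by
  obtain ⟨j, hj, hwj⟩ := exists_ne_apply_ne_zero_of_abs_lt_one hQ hQ11
  obtain ⟨S, c, hS, hc, hSprop, hint⟩ :=
    exists_thin_set hj hδ.le (w := fun i => Q i ⟨0, by omega⟩) hwj
  rw [Fintype.card_fin] at hint
  set a : ℝ := (d + 1 + δ - 2 * r) / 2 with ha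
  have hd' : (2 : ℝ) ≤ d := by exact_mod_cast hd
  set F : EuclideanSpace ℝ (Fin d) → ℝ := S.indicator fun ξ => ‖ξ‖ ^ (-a)
  have hFS : ∀ ξ ∈ S, F ξ = ‖ξ‖ ^ (-a) := fun ξ hξ => Set.indicator_of_mem hξ _
  have hF0 : ∀ ξ ∉ S, F ξ = 0 := fun ξ hξ => Set.indicator_of_notMem hξ _
  have hFsq : ∀ ξ ∈ S, ENNReal.ofReal (F ξ) ^ 2 = ENNReal.ofReal (‖ξ‖ ^ (-2 * a)) := by
    intro ξ hξ
    have h0 := (hSprop ξ hξ).1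
    rw [hFS ξ hξ, ← ENNReal.ofReal_pow (by positivity), ← Real.rpow_natCast, ← Real.rpow_mul h0.le]
    congr 2
    push_cast
    ring
  have hsupp : ∀ (g : EuclideanSpace ℝ (Fin d) → ENNReal), (∀ ξ ∉ S, g ξ = 0) →
      ∫⁻ ξ, g ξ = ∫⁻ ξ in S, g ξ := by
    intro g hg
    rw [← lintegral_indicator hS]
    congr 1
    refine (Set.indicator_eq_self.2 fun ξ hξ => ?_).symm
    by_contra hn
    exact hξ (hg ξ hn)
  refine ⟨F, ?_, ?_, ?_, ?_, ?_, ?_, ?_⟩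
  · exact (measurable_norm.pow_const _).indicator hS
  · exact fun ξ => Set.indicator_nonneg (fun ξ _ => by positivity) ξ
  · refine fun ξ hξ => hF0 ξ fun hmem => hξ ?_
    simpa using (hSprop ξ hmem).2.1.le
  · rw [hsupp _ fun ξ hξ => by simp [hF0 ξ hξ],
      setLIntegral_congr_fun hS fun ξ hξ => by rw [hFS ξ hξ]]
    exact (hint _).1 (by linarith)
  · rw [hsupp _ fun ξ hξ => by simp [hF0 ξ hξ]]
    have hle : ∀ ξ ∈ S, omegaW d (by omega) s r δ ξ * ENNReal.ofReal (F ξ) ^ 2 ≤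
        ENNReal.ofReal 2 * ENNReal.ofReal (‖ξ‖ ^ (2 * δ - 2 * r - 2 * a)) := by
      intro ξ hξ
      obtain ⟨h0, h1, h2, -⟩ := hSprop ξ hξ
      rw [hFsq ξ hξ, omegaW, if_pos h1, ← ENNReal.ofReal_mul (by positivity),
        ← ENNReal.ofReal_mul (by positivity)]
      refine ENNReal.ofReal_le_ofReal ?_
      have h3 : |ξ ⟨0, by omega⟩| ^ 2 ≤ ‖ξ‖ ^ (2 * δ) := by
        rw [mul_comm, Real.rpow_mul h0.le, Real.rpow_two]
        gcongr
      rw [show 2 * δ - 2 * r - 2 * a = 2 * δ - 2 * r + -2 * a by ring, Real.rpow_add h0,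
        Real.rpow_sub h0, ← mul_assoc, ← mul_div_assoc 2]
      gcongr
      linarith
    refine (setLIntegral_mono' hS hle).trans_lt ?_
    rw [lintegral_const_mul' _ _ ENNReal.ofReal_ne_top]
    exact ENNReal.mul_lt_top ENNReal.ofReal_lt_top ((hint _).1 (by linarith))
  · rw [hsupp _ fun ξ hξ => by simp [hF0 ξ hξ], setLIntegral_congr_fun hS hFsq]
    exact (hint _).2 (by linarith)
  · rw [hsupp _ fun ξ hξ => by simp [hF0 ξ hξ]]
    have hle : ∀ ξ ∈ S, ENNReal.ofReal (c ^ 2) * ENNReal.ofReal (‖ξ‖ ^ (2 - 2 * r - 2 * a)) ≤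
        omegaW d (by omega) s r δ (Matrix.toEuclideanLin Qᵀ ξ) * ENNReal.ofReal (F ξ) ^ 2 := by
      intro ξ hξ
      obtain ⟨h0, h1, -, h2⟩ := hSprop ξ hξ
      have hcoord : Matrix.toEuclideanLin Qᵀ ξ ⟨0, by omega⟩ =
          ∑ i, Q i ⟨0, by omega⟩ * ξ i := by
        simp [Matrix.mulVec, dotProduct]
      rw [hFsq ξ hξ, omegaW, norm_toEuclideanLin_transpose hQ, if_pos h1, hcoord,
        ← ENNReal.ofReal_mul (by positivity), ← ENNReal.ofReal_mul (by positivity)]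
      refine ENNReal.ofReal_le_ofReal ?_
      rw [show 2 - 2 * r - 2 * a = 2 - 2 * r + -2 * a by ring, Real.rpow_add h0,
        Real.rpow_sub h0, ← mul_assoc, ← mul_div_assoc, Real.rpow_two, ← mul_pow]
      gcongr
      refine le_add_of_le_of_nonneg ?_ (by positivity)
      gcongr
    refine top_unique (le_trans (le_of_eq ?_) (setLIntegral_mono' hS hle))
    rw [lintegral_const_mul' _ _ ENNReal.ofReal_ne_top, (hint _).2 (by linarith),
      ENNReal.mul_top]
    simpa using hc.ne'
end

section
/- Let d ≥ 2 be an integer and let s, r, δ, τ ∈ ℝ satisfy δ > 1, 1 − r ≤ s, and δ − r ≤ τ ≤ s. Then there exists a constant C > 0 such that for every measurable g : ℝ^d → ℂ, ∫_{ℝ^d} (1 + |ξ|²)^{s−τ} |ξ|^{2τ} |g(ξ)|² dξ + ∫_{ℝ^d} (|ξ₁|²/|ξ|^{2r}) |g(ξ)|² dξ ≤ C ∫_{ℝ^d} ω_{s,r,δ}(ξ) |g(ξ)|² dξ. (This expresses that for f ∈ X^s_{r,δ} one has (−Δ)^{τ/2} f ∈ H^{s−τ} and ∂₁ f ∈ Ḣ^{−r}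 with the corresponding norm estimate.) -/
open MeasureTheory

theorem rpow_le_two_rpow_abs_mul_one_add_rpow {y : ℝ} (hy : 1 ≤ y) (a : ℝ) :
    y ^ a ≤ 2 ^ |a| * (1 + y) ^ a := by
  rcases le_total 0 a with ha | ha
  · calc y ^ a ≤ (1 + y) ^ a := Real.rpow_le_rpow (by linarith) (by linarith) ha
      _ ≤ 2 ^ |a| * (1 + y) ^ a :=
        le_mul_of_one_le_left (by positivity) (Real.one_le_rpow one_le_two (abs_nonneg a))
  · calc y ^ a = 2 ^ |a| * (2 * y) ^ a := by
          rw [Real.mul_rpow zero_le_two (by linarith), ← mul_assoc,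
            ← Real.rpow_add zero_lt_two, abs_of_nonpos ha, neg_add_cancel, Real.rpow_zero, one_mul]
      _ ≤ 2 ^ |a| * (1 + y) ^ a := by
          gcongr ?_ * ?_
          exact Real.rpow_le_rpow_of_nonpos (by linarith) (by linarith) ha

theorem one_add_sq_rpow_mul_rpow_le_of_lt_one {x a s r δ τ : ℝ} (hx0 : 0 < x) (hx : x < 1)
    (h2 : δ - r ≤ τ) (h3 : τ ≤ s) :
    (1 + x ^ 2) ^ (s - τ) * x ^ (2 * τ) ≤
      2 ^ (s - τ) * ((a ^ 2 + x ^ (2 * δ)) / x ^ (2 * r)) := by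
  have hsq : x ^ 2 ≤ 1 := pow_le_one₀ hx0.le hx.le
  have hbase : (1 + x ^ 2) ^ (s - τ) ≤ (2 : ℝ) ^ (s - τ) :=
    Real.rpow_le_rpow (by positivity) (by linarith) (by linarith)
  have hpow : x ^ (2 * τ) ≤ (a ^ 2 + x ^ (2 * δ)) / x ^ (2 * r) := calc
    x ^ (2 * τ) ≤ x ^ (2 * δ - 2 * r) :=
      Real.rpow_le_rpow_of_exponent_ge hx0 hx.le (by linarith)
    _ = x ^ (2 * δ) / x ^ (2 * r) := Real.rpow_sub hx0 _ _
    _ ≤ (a ^ 2 + x ^ (2 * δ)) / x ^ (2 * r) := by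
      gcongr
      linarith [sq_nonneg a]
  gcongr

theorem one_add_sq_rpow_mul_rpow_le_of_one_le {x : ℝ} (hx : 1 ≤ x) (s τ : ℝ) :
    (1 + x ^ 2) ^ (s - τ) * x ^ (2 * τ) ≤ 2 ^ |τ| * (1 + x ^ 2) ^ s := by
  have hx0 : 0 < x := by linarith
  have key := rpow_le_two_rpow_abs_mul_one_add_rpow (one_le_pow₀ hx : 1 ≤ x ^ 2) τ
  calc (1 + x ^ 2) ^ (s - τ) * x ^ (2 * τ) = (1 + x ^ 2) ^ (s - τ) * (x ^ 2) ^ τ := by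
        rw [Real.rpow_mul hx0.le, Real.rpow_two]
    _ ≤ (1 + x ^ 2) ^ (s - τ) * (2 ^ |τ| * (1 + x ^ 2) ^ τ) := by gcongr
    _ = 2 ^ |τ| * (1 + x ^ 2) ^ s := by
        rw [mul_left_comm, ← Real.rpow_add (by positivity), sub_add_cancel]

theorem sq_div_rpow_le_of_one_le {x a s r : ℝ} (hx : 1 ≤ x) (ha : |a| ≤ x) (h1 : 1 - r ≤ s) :
    a ^ 2 / x ^ (2 * r) ≤ 2 ^ |1 - r| * (1 + x ^ 2) ^ s := by
  have hx0 : 0 < x := by linarith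
  have hax : a ^ 2 ≤ x ^ 2 := sq_le_sq' (abs_le.mp ha).1 (abs_le.mp ha).2
  calc a ^ 2 / x ^ (2 * r) ≤ x ^ 2 / x ^ (2 * r) := by gcongr
    _ = (x ^ 2) ^ (1 - r) := by
        rw [Real.rpow_sub (by positivity), Real.rpow_one, Real.rpow_mul hx0.le, Real.rpow_two]
    _ ≤ 2 ^ |1 - r| * (1 + x ^ 2) ^ (1 - r) :=
        rpow_le_two_rpow_abs_mul_one_add_rpow (one_le_pow₀ hx) _
    _ ≤ 2 ^ |1 - r| * (1 + x ^ 2) ^ s := by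
        gcongr
        exact le_add_of_nonneg_right (sq_nonneg x)

theorem ofReal_smoothness_weight_le_omegaW {d : ℕ} (hd : 0 < d) {s r δ τ : ℝ}
    (h2 : δ - r ≤ τ) (h3 : τ ≤ s) {ξ : EuclideanSpace ℝ (Fin d)} (hξ : ξ ≠ 0) :
    ENNReal.ofReal ((1 + ‖ξ‖ ^ 2) ^ (s - τ) * ‖ξ‖ ^ (2 * τ)) ≤
      ENNReal.ofReal (2 ^ (s - τ) + 2 ^ |τ|) * omegaW d hd s r δ ξ := by
  unfold omegaW
  split_ifs with hx <;> rw [← ENNReal.ofReal_mul (by positivity)] <;>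
    apply ENNReal.ofReal_le_ofReal
  · refine (one_add_sq_rpow_mul_rpow_le_of_lt_one (norm_pos_iff.mpr hξ) hx h2 h3).trans
      (mul_le_mul_of_nonneg_right ?_ (by positivity))
    exact le_add_of_nonneg_right (by positivity)
  · refine (one_add_sq_rpow_mul_rpow_le_of_one_le (not_lt.mp hx) s τ).trans
      (mul_le_mul_of_nonneg_right ?_ (by positivity))
    exact le_add_of_nonneg_left (by positivity)

theorem ofReal_sq_div_rpow_le_omegaW {d : ℕ} (hd : 0 < d) {s r : ℝ} (δ : ℝ) (h1 : 1 - r ≤ s)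
    (ξ : EuclideanSpace ℝ (Fin d)) :
    ENNReal.ofReal ((ξ ⟨0, hd⟩) ^ 2 / ‖ξ‖ ^ (2 * r)) ≤
      ENNReal.ofReal (2 ^ |1 - r|) * omegaW d hd s r δ ξ := by
  unfold omegaW
  split_ifs with hx <;> rw [← ENNReal.ofReal_mul (by positivity)] <;>
    apply ENNReal.ofReal_le_ofReal
  · rw [sq_abs]
    refine le_trans ?_ (le_mul_of_one_le_left (by positivity)
      (Real.one_le_rpow one_le_two (abs_nonneg _)))
    gcongr
    exact le_add_of_nonneg_right (by positivity)
  · exact sq_div_rpow_le_of_one_le (not_lt.mp hx) (PiLp.norm_apply_le ξ _) h1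

theorem stmt8 (d : ℕ) (hd : 2 ≤ d) (s r δ τ : ℝ) (hδ : 1 < δ)
    (h1 : 1 - r ≤ s) (h2 : δ - r ≤ τ) (h3 : τ ≤ s) :
    ∃ C : ℝ, 0 < C ∧ ∀ g : EuclideanSpace ℝ (Fin d) → ℂ, Measurable g →
      (∫⁻ ξ, ENNReal.ofReal ((1 + ‖ξ‖ ^ 2) ^ (s - τ) * ‖ξ‖ ^ (2 * τ)) *
          (‖g ξ‖₊ : ENNReal) ^ 2) +
        (∫⁻ ξ, ENNReal.ofReal ((ξ ⟨0, by omega⟩) ^ 2 / ‖ξ‖ ^ (2 * r)) *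
          (‖g ξ‖₊ : ENNReal) ^ 2) ≤
      ENNReal.ofReal C *
        ∫⁻ ξ, omegaW d (by omega) s r δ ξ * (‖g ξ‖₊ : ENNReal) ^ 2 := by
  have : Nonempty (Fin d) := ⟨⟨0, by omega⟩⟩
  refine ⟨(2 ^ (s - τ) + 2 ^ |τ|) + 2 ^ |1 - r|, by positivity, fun g _ => ?_⟩
  rw [ENNReal.ofReal_add (by positivity) (by positivity), add_mul,
    ← lintegral_const_mul' _ _ ENNReal.ofReal_ne_top,
    ← lintegral_const_mul' _ _ ENNReal.ofReal_ne_top]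
  refine add_le_add (lintegral_mono_ae ?_) (lintegral_mono fun ξ => ?_)
  · filter_upwards [Measure.ae_ne volume (0 : EuclideanSpace ℝ (Fin d))] with ξ hξ
    rw [← mul_assoc]
    gcongr
    exact ofReal_smoothness_weight_le_omegaW _ h2 h3 hξ
  · dsimp only
    rw [← mul_assoc]
    gcongr
    exact ofReal_sq_div_rpow_le_omegaW _ δ h1 ξ
end

section
/- Let d ≥ 2 be an integer and let s, r, δ ∈ ℝ satisfy δ > 1, d > 1 + δ − 2r, and s > d/2. Then there exists a constant C > 0 such that for all measurable F, G : ℝ^d → [0,∞), ∫_{ℝ^d} (1 + |ξ|²)^s (F∗G)(ξ)² dξ ≤ C² (∫_{ℝ^d} ω_{s,r,δ}(ξ) F(ξ)² dξ) (∫_{ℝ^d} (1 + |ξ|²)^s G(ξ)² dξ), where (F∗G)(ξ) = ∫_{ℝ^d} F(ξ−η) G(η) dη. (This expresses on the Fourier side that if f ∈ X^s_{r,δ} and g ∈ H^s, then fg ∈ H^s with ‖fg‖_{H^s} ≤ C‖f‖_{X^s_{r,δ}}‖g‖_{H^s}.) -/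
open MeasureTheory

/-- Convolution of two nonnegative functions, valued in `[0,∞]`. -/
noncomputable def convNN (d : ℕ) (F G : EuclideanSpace ℝ (Fin d) → ℝ)
    (ξ : EuclideanSpace ℝ (Fin d)) : ENNReal :=
  ∫⁻ η, ENNReal.ofReal (F (ξ - η)) * ENNReal.ofReal (G η)

open scoped ENNReal

/-- Cauchy–Schwarz for `lintegral`, for a function whose square is dominated by a product. -/
lemma sq_lintegral_le_of_sq_le_mul {α : Type*} [MeasurableSpace α] {μ : Measure α}
    {f v g : α → ℝ≥0∞} (hv : AEMeasurable v μ) (hg : AEMeasurable g μ)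
    (h : ∀ᵐ x ∂μ, f x ^ 2 ≤ v x * g x) :
    (∫⁻ x, f x ∂μ) ^ 2 ≤ (∫⁻ x, v x ∂μ) * ∫⁻ x, g x ∂μ := by
  have sq_sqrt : ∀ a : ℝ≥0∞, (a ^ (1 / 2 : ℝ)) ^ 2 = a := fun a => by
    rw [← ENNReal.rpow_natCast, ← ENNReal.rpow_mul]; norm_num
  have hle : ∫⁻ x, f x ∂μ ≤
      ∫⁻ x, ((fun x => v x ^ (1 / 2 : ℝ)) * fun x => g x ^ (1 / 2 : ℝ)) x ∂μ := by
    refine lintegral_mono_ae (h.mono fun x hx => ?_)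
    rw [Pi.mul_apply, ← ENNReal.pow_le_pow_left_iff two_ne_zero, mul_pow, sq_sqrt, sq_sqrt]
    exact hx
  have hcs := ENNReal.lintegral_mul_le_Lp_mul_Lq μ Real.HolderConjugate.two_two
    (hv.pow_const (1 / 2 : ℝ)) (hg.pow_const (1 / 2 : ℝ))
  have key := pow_le_pow_left₀ (zero_le) (hle.trans hcs) 2
  simpa only [mul_pow, sq_sqrt, ENNReal.rpow_two] using key

/-- Young's convolution inequality `L¹ ∗ L² ⊆ L²`. -/
lemma lintegral_sq_conv_le {E : Type*} [NormedAddCommGroup E] [MeasurableSpace E] [BorelSpace E]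
    [SecondCountableTopology E] {μ : Measure E} [SFinite μ] [μ.IsAddLeftInvariant]
    [μ.IsNegInvariant] {a b : E → ℝ≥0∞} (ha : Measurable a) (hb : Measurable b) :
    ∫⁻ ξ, (∫⁻ η, a (ξ - η) * b η ∂μ) ^ 2 ∂μ ≤ (∫⁻ ξ, a ξ ∂μ) ^ 2 * ∫⁻ ξ, b ξ ^ 2 ∂μ := by
  have hpt : ∀ ξ, (∫⁻ η, a (ξ - η) * b η ∂μ) ^ 2 ≤
      (∫⁻ x, a x ∂μ) * ∫⁻ η, a (ξ - η) * b η ^ 2 ∂μ := fun ξ => by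
    rw [← lintegral_sub_left_eq_self a ξ]
    refine sq_lintegral_le_of_sq_le_mul (by fun_prop) (by fun_prop) (.of_forall fun η => ?_)
    exact le_of_eq (by ring)
  calc ∫⁻ ξ, (∫⁻ η, a (ξ - η) * b η ∂μ) ^ 2 ∂μ
      ≤ ∫⁻ ξ, (∫⁻ x, a x ∂μ) * ∫⁻ η, a (ξ - η) * b η ^ 2 ∂μ ∂μ := lintegral_mono hpt
    _ = (∫⁻ x, a x ∂μ) * ∫⁻ ξ, ∫⁻ η, a (ξ - η) * b η ^ 2 ∂μ ∂μ :=
        lintegral_const_mul _ (Measurable.lintegral_prod_right (by fun_prop))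
    _ = (∫⁻ x, a x ∂μ) * ∫⁻ η, ∫⁻ ξ, a (ξ - η) * b η ^ 2 ∂μ ∂μ := by
        rw [lintegral_lintegral_swap (by fun_prop)]
    _ = (∫⁻ x, a x ∂μ) * ∫⁻ η, (∫⁻ x, a x ∂μ) * b η ^ 2 ∂μ := by
        congr 1
        refine lintegral_congr fun η => ?_
        rw [lintegral_mul_const _ (by fun_prop), lintegral_sub_right_eq_self]
    _ = (∫⁻ ξ, a ξ ∂μ) ^ 2 * ∫⁻ ξ, b ξ ^ 2 ∂μ := by
        rw [lintegral_const_mul _ (by fun_prop)]; ring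

/-- The mirrored form of `lintegral_sq_conv_le`: Young's inequality `L² ∗ L¹ ⊆ L²`. -/
lemma lintegral_sq_conv_le' {E : Type*} [NormedAddCommGroup E] [MeasurableSpace E] [BorelSpace E]
    [SecondCountableTopology E] {μ : Measure E} [SFinite μ] [μ.IsAddLeftInvariant]
    [μ.IsNegInvariant] {a b : E → ℝ≥0∞} (ha : Measurable a) (hb : Measurable b) :
    ∫⁻ ξ, (∫⁻ η, a (ξ - η) * b η ∂μ) ^ 2 ∂μ ≤ (∫⁻ ξ, a ξ ^ 2 ∂μ) * (∫⁻ ξ, b ξ ∂μ) ^ 2 := by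
  rw [mul_comm]
  refine le_trans (le_of_eq (lintegral_congr fun ξ => ?_)) (lintegral_sq_conv_le hb ha)
  rw [← lintegral_sub_left_eq_self _ ξ]
  simp only [sub_sub_cancel, mul_comm]

lemma integrable_indicator_abs_rpow {κ : ℝ} (h : κ < 1) :
    Integrable ((Set.Ioc (-1 : ℝ) 1).indicator fun x => |x| ^ (-κ)) := by
  have h01 : IntervalIntegrable (fun x : ℝ => |x| ^ (-κ)) volume 0 1 :=
    (intervalIntegral.intervalIntegrable_rpow' (r := -κ) (by linarith)).congr fun x hx => by
      rw [Set.uIoc_of_le zero_le_one] at hx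
      simp only [abs_of_pos hx.1]
  have hneg : IntervalIntegrable (fun x : ℝ => |x| ^ (-κ)) volume (-1) 0 := by
    have := (IntervalIntegrable.iff_comp_neg (by finiteness)).1 h01
    simp only [abs_neg, neg_zero] at this
    exact this.symm
  rw [integrable_indicator_iff measurableSet_Ioc]
  exact (intervalIntegrable_iff_integrableOn_Ioc_of_le (by norm_num)).1 (hneg.trans h01)

lemma ae_coord_ne_zero (d : ℕ) :
    ∀ᵐ ξ : EuclideanSpace ℝ (Fin d), ∀ j, ξ j ≠ 0 := by
  refine ae_all_iff.2 fun j => ?_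
  exact (PiLp.volume_preserving_ofLp (Fin d)).quasiMeasurePreserving.ae
    ((Measure.ae_eval_ne (fun _ : Fin d => (volume : Measure ℝ)) j 0))

/-- Near the origin `ω` dominates a product of one-dimensional powers with exponent less than `1`;
this is where the condition `1 + δ - 2 r < d` enters. -/
lemma exists_prod_abs_rpow_le {d : ℕ} (hd : 0 < d) {r δ : ℝ} (hδ : 1 < δ)
    (hdim : 1 + δ - 2 * r < (d : ℝ)) :
    ∃ κ : ℝ, 0 < κ ∧ κ < 1 ∧ ∀ ξ : EuclideanSpace ℝ (Fin d), ξ ⟨0, hd⟩ ≠ 0 → ‖ξ‖ < 1 →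
      ∏ j, |ξ j| ^ κ ≤ (|ξ ⟨0, hd⟩| ^ 2 + ‖ξ‖ ^ (2 * δ)) / ‖ξ‖ ^ (2 * r) := by
  have hd1 : (1 : ℝ) ≤ d := by exact_mod_cast hd
  have hden : 0 < d - 1 + δ := by linarith
  obtain ⟨κ, hκ, hκ1⟩ := exists_between (show max 0 ((2 * δ - 2 * r) / (d - 1 + δ)) < 1 from
    max_lt one_pos ((div_lt_one hden).2 (by linarith)))
  have hκ0 : 0 < κ := (le_max_left _ _).trans_lt hκ
  have hκ2 : 2 * δ - 2 * r < κ * (d - 1 + δ) :=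
    (div_lt_iff₀ hden).1 ((le_max_right _ _).trans_lt hκ)
  refine ⟨κ, hκ0, hκ1, fun ξ h0 hξ => ?_⟩
  set i : Fin d := ⟨0, hd⟩
  have hle : ∀ j, |ξ j| ≤ ‖ξ‖ := fun j => by simpa using PiLp.norm_apply_le ξ j
  set x := |ξ i| with hx
  have hx0 : 0 < x := abs_pos.2 h0
  set ρ := ‖ξ‖
  have hρ : 0 < ρ := hx0.trans_le (hle i)
  have hprod : ∏ j, |ξ j| ^ κ ≤ x ^ κ * ρ ^ ((d - 1) * κ) := by
    rw [← Finset.mul_prod_erase _ _ (Finset.mem_univ i)]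
    gcongr
    calc ∏ j ∈ Finset.univ.erase i, |ξ j| ^ κ
        ≤ ∏ j ∈ Finset.univ.erase i, ρ ^ κ := by
          gcongr with j
          exact hle j
      _ = ρ ^ ((d - 1) * κ) := by
          rw [Finset.prod_const, Finset.card_erase_of_mem (Finset.mem_univ i), Finset.card_univ,
            Fintype.card_fin, ← Real.rpow_mul_natCast hρ.le, Nat.cast_sub hd, Nat.cast_one,
            mul_comm]
  have hmax : x ^ κ * ρ ^ (δ * (2 - κ)) ≤ x ^ 2 + ρ ^ (2 * δ) := by
    rw [Real.rpow_mul hρ.le, mul_comm 2 δ, Real.rpow_mul hρ.le, Real.rpow_two]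
    have hy : 0 < ρ ^ δ := Real.rpow_pos_of_pos hρ δ
    generalize ρ ^ δ = y at hy
    calc x ^ κ * y ^ (2 - κ) ≤ max x y ^ κ * max x y ^ (2 - κ) := by
          gcongr
          · exact le_max_left _ _
          · linarith
          · exact le_max_right _ _
      _ = max x y ^ 2 := by
          rw [← Real.rpow_add (lt_max_of_lt_left hx0), ← Real.rpow_two]; congr 1; ring
      _ ≤ x ^ 2 + y ^ 2 := by
          rcases max_cases x y with ⟨h, -⟩ | ⟨h, -⟩ <;> rw [h] <;> nlinarith [sq_nonneg x, sq_nonneg y]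
  rw [le_div_iff₀ (by positivity)]
  calc (∏ j, |ξ j| ^ κ) * ρ ^ (2 * r)
      ≤ x ^ κ * ρ ^ ((d - 1) * κ) * ρ ^ (2 * r) := by gcongr
    _ = x ^ κ * ρ ^ ((d - 1) * κ + 2 * r) := by rw [mul_assoc, ← Real.rpow_add hρ]
    _ ≤ x ^ κ * ρ ^ (δ * (2 - κ)) := by
        gcongr x ^ κ * ?_
        exact Real.rpow_le_rpow_of_exponent_ge hρ hξ.le (by nlinarith)
    _ ≤ _ := hmax

lemma lintegral_one_add_norm_sq_rpow_neg_lt_top {d : ℕ} {s : ℝ} (hs : (d : ℝ) / 2 < s) :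
    ∫⁻ ξ : EuclideanSpace ℝ (Fin d), ENNReal.ofReal ((1 + ‖ξ‖ ^ 2) ^ (-s)) < ∞ := by
  have h := integrable_rpow_neg_one_add_norm_sq (E := EuclideanSpace ℝ (Fin d)) (μ := volume)
    (r := 2 * s) (by rw [finrank_euclideanSpace_fin]; linarith)
  rw [show -(2 * s) / 2 = -s by ring] at h
  exact h.lintegral_lt_top

/-- `1 / ω` is dominated almost everywhere by an integrable function. -/
lemma exists_one_le_mul_omegaW {d : ℕ} (hd : 0 < d) {s r δ : ℝ} (hδ : 1 < δ)
    (hdim : 1 + δ - 2 * r < (d : ℝ)) (hs : (d : ℝ) / 2 < s) :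
    ∃ v : EuclideanSpace ℝ (Fin d) → ℝ≥0∞, Measurable v ∧ ∫⁻ ξ, v ξ < ∞ ∧
      ∀ᵐ ξ, 1 ≤ v ξ * omegaW d hd s r δ ξ := by
  obtain ⟨κ, hκ0, hκ1, hκ⟩ := exists_prod_abs_rpow_le hd hδ hdim
  let φ : ℝ → ℝ := (Set.Ioc (-1 : ℝ) 1).indicator fun x => |x| ^ (-κ)
  have hφm : Measurable φ := Measurable.indicator (by fun_prop) measurableSet_Ioc
  have hφi : ∫⁻ ξ : EuclideanSpace ℝ (Fin d), ENNReal.ofReal (∏ j, φ (ξ j)) < ∞ := by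
    have h : Integrable (fun x : Fin d → ℝ => ∏ j, φ (x j)) :=
      Integrable.fintype_prod fun _ => integrable_indicator_abs_rpow hκ1
    exact ((PiLp.volume_preserving_ofLp (Fin d)).integrable_comp_of_integrable h).lintegral_lt_top
  have hpm : Measurable fun ξ : EuclideanSpace ℝ (Fin d) => ENNReal.ofReal (∏ j, φ (ξ j)) := by
    fun_prop
  refine ⟨fun ξ => ENNReal.ofReal (∏ j, φ (ξ j)) + ENNReal.ofReal ((1 + ‖ξ‖ ^ 2) ^ (-s)),
    by fun_prop, ?_, ?_⟩
  · rw [lintegral_add_left hpm]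
    exact ENNReal.add_lt_top.2 ⟨hφi, lintegral_one_add_norm_sq_rpow_neg_lt_top hs⟩
  filter_upwards [ae_coord_ne_zero d] with ξ hξ
  unfold omegaW
  split_ifs with h
  · have hφ : ∀ j, φ (ξ j) = |ξ j| ^ (-κ) := fun j => by
      have hj : |ξ j| < 1 := lt_of_le_of_lt (by simpa using PiLp.norm_apply_le ξ j) h
      exact Set.indicator_of_mem (Set.mem_Ioc.2 ⟨(abs_lt.1 hj).1, (abs_lt.1 hj).2.le⟩) _
    have hpos : 0 ≤ ∏ j, φ (ξ j) := Finset.prod_nonneg fun j _ => by rw [hφ]; positivity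
    calc (1 : ℝ≥0∞) = ENNReal.ofReal ((∏ j, φ (ξ j)) * ∏ j, |ξ j| ^ κ) := by
          rw [← Finset.prod_mul_distrib, Finset.prod_eq_one, ENNReal.ofReal_one]
          intro j _
          rw [hφ, ← Real.rpow_add (abs_pos.2 (hξ j)), neg_add_cancel, Real.rpow_zero]
      _ = ENNReal.ofReal (∏ j, φ (ξ j)) * ENNReal.ofReal (∏ j, |ξ j| ^ κ) :=
          ENNReal.ofReal_mul hpos
      _ ≤ _ := by
          gcongr
          · exact le_self_add
          · exact hκ ξ (hξ _) h
  · calc (1 : ℝ≥0∞)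
        = ENNReal.ofReal ((1 + ‖ξ‖ ^ 2) ^ (-s)) * ENNReal.ofReal ((1 + ‖ξ‖ ^ 2) ^ s) := by
          rw [← ENNReal.ofReal_mul (by positivity), ← Real.rpow_add (by positivity),
            neg_add_cancel, Real.rpow_zero, ENNReal.ofReal_one]
      _ ≤ _ := by
          gcongr
          exact le_add_self

lemma measurable_omegaW {d : ℕ} (hd : 0 < d) (s r δ : ℝ) : Measurable (omegaW d hd s r δ) :=
  Measurable.ite (measurableSet_lt (by fun_prop) (by fun_prop)) (by fun_prop) (by fun_prop)

/-- A Peetre-type inequality which needs the weight of `x - y` only when `1 ≤ ‖x - y‖`. -/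
lemma one_add_norm_sq_rpow_le {E : Type*} [NormedAddCommGroup E] {t : ℝ} (ht : 0 ≤ t) (x y : E) :
    (1 + ‖x‖ ^ 2) ^ t ≤ 4 ^ t * ((1 + ‖y‖ ^ 2) ^ t +
      {z : E | 1 ≤ ‖z‖}.indicator (fun z => (1 + ‖z‖ ^ 2) ^ t) (x - y)) := by
  have hx : ‖x‖ ≤ ‖x - y‖ + ‖y‖ := by simpa using norm_add_le (x - y) y
  have hx2 : ‖x‖ ^ 2 ≤ 2 * ‖x - y‖ ^ 2 + 2 * ‖y‖ ^ 2 := by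
    nlinarith [sq_nonneg (‖x - y‖ - ‖y‖), norm_nonneg x]
  have hy : (1 + ‖x‖ ^ 2) ≤ 4 * (1 + ‖y‖ ^ 2) →
      (1 + ‖x‖ ^ 2) ^ t ≤ 4 ^ t * (1 + ‖y‖ ^ 2) ^ t := fun h => by
    rw [← Real.mul_rpow (by norm_num) (by positivity)]
    gcongr
  by_cases h : 1 ≤ ‖x - y‖
  · rw [Set.indicator_of_mem (show x - y ∈ {z : E | 1 ≤ ‖z‖} from h), mul_add]
    rcases le_total ‖x - y‖ ‖y‖ with hc | hc
    · refine (hy ?_).trans (le_add_of_nonneg_right (by positivity))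
      nlinarith [norm_nonneg (x - y)]
    · refine le_add_of_nonneg_of_le (by positivity) ?_
      rw [← Real.mul_rpow (by norm_num) (by positivity)]
      gcongr
      nlinarith [norm_nonneg y]
  · rw [Set.indicator_of_notMem (show x - y ∉ {z : E | 1 ≤ ‖z‖} from h), add_zero]
    apply hy
    nlinarith [norm_nonneg (x - y), sq_nonneg ‖y‖, not_le.1 h]

theorem stmt9 (d : ℕ) (hd : 2 ≤ d) (s r δ : ℝ) (hδ : 1 < δ)
    (hdim : 1 + δ - 2 * r < (d : ℝ)) (hs : (d : ℝ) / 2 < s) :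
    ∃ C : ℝ, 0 < C ∧ ∀ F G : EuclideanSpace ℝ (Fin d) → ℝ,
      Measurable F → (∀ ξ, 0 ≤ F ξ) → Measurable G → (∀ ξ, 0 ≤ G ξ) →
      (∫⁻ ξ, ENNReal.ofReal ((1 + ‖ξ‖ ^ 2) ^ s) * (convNN d F G ξ) ^ 2) ≤
      ENNReal.ofReal C ^ 2 *
        ((∫⁻ ξ, omegaW d (by omega) s r δ ξ * ENNReal.ofReal (F ξ) ^ 2) *
         (∫⁻ ξ, ENNReal.ofReal ((1 + ‖ξ‖ ^ 2) ^ s) * ENNReal.ofReal (G ξ) ^ 2)) := by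
  have hd0 : 0 < d := by omega
  have hs0 : 0 < s := lt_of_le_of_lt (by positivity) hs
  obtain ⟨v, hvm, hvi, hv⟩ := exists_one_le_mul_omegaW hd0 hδ hdim hs
  let S : Set (EuclideanSpace ℝ (Fin d)) := {z | 1 ≤ ‖z‖}
  have hS : MeasurableSet S := measurableSet_le measurable_const measurable_norm
  let k : EuclideanSpace ℝ (Fin d) → ℝ≥0∞ := fun ξ => ENNReal.ofReal ((1 + ‖ξ‖ ^ 2) ^ (s / 2))
  let c : ℝ≥0∞ := ENNReal.ofReal (4 ^ (s / 2))
  have hkm : Measurable k := by fun_prop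
  have hk2 : ∀ ξ, ENNReal.ofReal ((1 + ‖ξ‖ ^ 2) ^ s) = k ξ ^ 2 := fun ξ => by
    rw [← ENNReal.ofReal_pow (by positivity), ← Real.rpow_mul_natCast (by positivity)]
    norm_num
  have hksub : ∀ ξ η, k ξ ≤ c * (k η + S.indicator k (ξ - η)) := fun ξ η => by
    have hind : S.indicator k (ξ - η) = ENNReal.ofReal
        (S.indicator (fun z => (1 + ‖z‖ ^ 2) ^ (s / 2)) (ξ - η)) := by
      simp only [Set.indicator, k]; split_ifs <;> simp
    have hnn : 0 ≤ S.indicator (fun z => (1 + ‖z‖ ^ 2) ^ (s / 2)) (ξ - η) :=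
      Set.indicator_nonneg (fun _ _ => by positivity) _
    rw [hind, ← ENNReal.ofReal_add (by positivity) hnn, ← ENNReal.ofReal_mul (by positivity)]
    exact ENNReal.ofReal_le_ofReal (one_add_norm_sq_rpow_le (by positivity) ξ η)
  let w : EuclideanSpace ℝ (Fin d) → ℝ≥0∞ := fun ξ => ENNReal.ofReal ((1 + ‖ξ‖ ^ 2) ^ (-s))
  have hwi : ∫⁻ ξ, w ξ < ∞ := lintegral_one_add_norm_sq_rpow_neg_lt_top hs
  have hwk : ∀ ξ, w ξ * k ξ ^ 2 = 1 := fun ξ => by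
    rw [← hk2, ← ENNReal.ofReal_mul (by positivity), ← Real.rpow_add (by positivity),
      neg_add_cancel, Real.rpow_zero, ENNReal.ofReal_one]
  set M : ℝ≥0∞ := c ^ 2 * (2 * ((∫⁻ ξ, v ξ) + ∫⁻ ξ, w ξ)) with hM
  have hMtop : M ≠ ∞ := by
    refine ENNReal.mul_ne_top (by simp [c]) (ENNReal.mul_ne_top (by simp) ?_)
    exact ENNReal.add_ne_top.2 ⟨hvi.ne, hwi.ne⟩
  refine ⟨M.toReal + 1, by positivity, fun F G hF _ hG _ => ?_⟩
  have hMC : M ≤ ENNReal.ofReal (M.toReal + 1) ^ 2 := by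
    calc M ≤ ENNReal.ofReal (M.toReal + 1) := by
          conv_lhs => rw [← ENNReal.ofReal_toReal hMtop]
          gcongr; linarith
      _ ≤ _ := le_self_pow (by simp) two_ne_zero
  refine le_trans ?_ (mul_le_mul_left hMC _)
  let f : EuclideanSpace ℝ (Fin d) → ℝ≥0∞ := fun ξ => ENNReal.ofReal (F ξ)
  let g : EuclideanSpace ℝ (Fin d) → ℝ≥0∞ := fun ξ => ENNReal.ofReal (G ξ)
  have hf : Measurable f := hF.ennreal_ofReal
  have hg : Measurable g := hG.ennreal_ofReal
  have hSk : Measurable (S.indicator k) := hkm.indicator hS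
  have hω := measurable_omegaW hd0 s r δ
  set Ω := ∫⁻ ξ, omegaW d hd0 s r δ ξ * f ξ ^ 2 with hΩ
  set W := ∫⁻ ξ, k ξ ^ 2 * g ξ ^ 2 with hW
  have hf1 : (∫⁻ ξ, f ξ) ^ 2 ≤ (∫⁻ ξ, v ξ) * Ω := by
    refine sq_lintegral_le_of_sq_le_mul hvm.aemeasurable (by fun_prop) (hv.mono fun ξ h => ?_)
    rw [← mul_assoc]
    exact le_mul_of_one_le_left (zero_le) h
  have hg1 : (∫⁻ ξ, g ξ) ^ 2 ≤ (∫⁻ ξ, w ξ) * W := by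
    refine sq_lintegral_le_of_sq_le_mul (by fun_prop) (by fun_prop) (.of_forall fun ξ => ?_)
    rw [← mul_assoc, hwk, one_mul]
  have hf2 : ∫⁻ ξ, (S.indicator k ξ * f ξ) ^ 2 ≤ Ω := by
    refine lintegral_mono fun ξ => ?_
    simp only [Set.indicator, omegaW, S, Set.mem_ofPred_eq]
    split_ifs with h1 h2
    · exact absurd h2 h1.not_gt
    · rw [hk2, mul_pow]
    · simp
    · linarith
  have hpt : ∀ ξ, ENNReal.ofReal ((1 + ‖ξ‖ ^ 2) ^ s) * convNN d F G ξ ^ 2 ≤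
      c ^ 2 * (2 * ((∫⁻ η, f (ξ - η) * (k η * g η)) ^ 2 +
        (∫⁻ η, (S.indicator k (ξ - η) * f (ξ - η)) * g η) ^ 2)) := fun ξ => by
    have hlin : k ξ * convNN d F G ξ ≤ c * ((∫⁻ η, f (ξ - η) * (k η * g η)) +
        ∫⁻ η, (S.indicator k (ξ - η) * f (ξ - η)) * g η) := by
      unfold convNN
      rw [← lintegral_add_left (by fun_prop), ← lintegral_const_mul _ (by fun_prop),
        ← lintegral_const_mul _ (by fun_prop)]
      refine lintegral_mono fun η => ?_
      calc k ξ * (f (ξ - η) * g η)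
          ≤ c * (k η + S.indicator k (ξ - η)) * (f (ξ - η) * g η) := by gcongr; exact hksub ξ η
        _ = _ := by ring
    rw [hk2, ← mul_pow]
    refine (pow_le_pow_left₀ (zero_le) hlin 2).trans ?_
    rw [mul_pow]
    gcongr
    have h2 := ENNReal.rpow_add_le_mul_rpow_add_rpow (∫⁻ η, f (ξ - η) * (k η * g η))
      (∫⁻ η, (S.indicator k (ξ - η) * f (ξ - η)) * g η) one_le_two
    rw [show (2 : ℝ) - 1 = 1 by norm_num, ENNReal.rpow_one] at h2
    simpa only [ENNReal.rpow_two] using h2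
  calc ∫⁻ ξ, ENNReal.ofReal ((1 + ‖ξ‖ ^ 2) ^ s) * convNN d F G ξ ^ 2
      ≤ ∫⁻ ξ, c ^ 2 * (2 * ((∫⁻ η, f (ξ - η) * (k η * g η)) ^ 2 +
        (∫⁻ η, (S.indicator k (ξ - η) * f (ξ - η)) * g η) ^ 2)) := lintegral_mono hpt
    _ = c ^ 2 * (2 * ((∫⁻ ξ, (∫⁻ η, f (ξ - η) * (k η * g η)) ^ 2) +
        ∫⁻ ξ, (∫⁻ η, (S.indicator k (ξ - η) * f (ξ - η)) * g η) ^ 2)) := by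
        have h1 : Measurable fun ξ => (∫⁻ η, f (ξ - η) * (k η * g η)) ^ 2 :=
          (Measurable.lintegral_prod_right (by fun_prop)).pow_const 2
        rw [lintegral_const_mul' _ _ (by simp [c]), lintegral_const_mul' _ _ (by simp),
          lintegral_add_left h1]
    _ ≤ c ^ 2 * (2 * ((∫⁻ ξ, v ξ) * Ω * W + Ω * ((∫⁻ ξ, w ξ) * W))) := by
        gcongr
        · refine (lintegral_sq_conv_le hf (hkm.mul hg)).trans ?_
          simp only [Pi.mul_apply, mul_pow]
          gcongr
        · refine (lintegral_sq_conv_le' (hSk.mul hf) hg).trans ?_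
          gcongr
          exact hf2
    _ = M * (Ω * W) := by rw [hM]; ring
    _ = _ := by simp only [hk2, hΩ, hW, f, g]
end

section
/- Let d ≥ 1 be an integer and let r, δ ∈ ℝ with 0 ≤ r ≤ δ. Then there exists a constant C > 0 such that for all nonzero ξ, η ∈ ℝ^d satisfying |ξ| + |η| ≤ 3·||ξ| − |η||, one has μ_{r,δ}(ξ+η) ≤ C (μ_{r,δ}(ξ) + μ_{r,δ}(η)). -/
open MeasureTheory

/-- The function `μ_{r,δ}(ξ) = (|ξ₁| + |ξ|^δ)/|ξ|^r`. -/
noncomputable def muW (d : ℕ) (hd : 0 < d) (r δ : ℝ)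
    (ξ : EuclideanSpace ℝ (Fin d)) : ℝ :=
  (|ξ ⟨0, hd⟩| + ‖ξ‖ ^ δ) / ‖ξ‖ ^ r

/-- The subadditivity bound for `muW` when the second vector is at most half as long as the
first. -/
theorem muW_add_le_of_two_mul_norm_le (d : ℕ) (hd : 0 < d) (r δ : ℝ) (hr : 0 ≤ r) (hδ : 0 ≤ δ)
    {ξ η : EuclideanSpace ℝ (Fin d)} (hξ : ξ ≠ 0) (hη : η ≠ 0) (h : 2 * ‖η‖ ≤ ‖ξ‖) :
    muW d hd r δ (ξ + η) ≤ 2 ^ δ * 2 ^ r * (muW d hd r δ ξ + muW d hd r δ η) := by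
  have ha : 0 < ‖ξ‖ := norm_pos_iff.2 hξ
  have hb : 0 < ‖η‖ := norm_pos_iff.2 hη
  have hupper : ‖ξ + η‖ ≤ 2 * ‖ξ‖ := by linarith [norm_add_le ξ η]
  have hlower : ‖ξ‖ ≤ 2 * ‖ξ + η‖ := by
    have := norm_sub_le (ξ + η) η
    rw [add_sub_cancel_right] at this
    linarith
  have hs : 0 < ‖ξ + η‖ := by linarith
  have hsδ : ‖ξ + η‖ ^ δ ≤ 2 ^ δ * ‖ξ‖ ^ δ := by
    rw [← Real.mul_rpow (by norm_num) ha.le]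
    exact Real.rpow_le_rpow hs.le hupper hδ
  have hsr : ‖ξ‖ ^ r ≤ 2 ^ r * ‖ξ + η‖ ^ r := by
    rw [← Real.mul_rpow (by norm_num) hs.le]
    exact Real.rpow_le_rpow ha.le hlower hr
  have hba : ‖η‖ ^ r ≤ ‖ξ‖ ^ r := Real.rpow_le_rpow hb.le (by linarith) hr
  have hδ1 : (1 : ℝ) ≤ 2 ^ δ := Real.one_le_rpow (by norm_num) hδ
  have hA : 0 < ‖ξ‖ ^ r := Real.rpow_pos_of_pos ha r
  have hB : 0 < ‖η‖ ^ r := Real.rpow_pos_of_pos hb r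
  have hS : 0 < ‖ξ + η‖ ^ r := Real.rpow_pos_of_pos hs r
  have hBδ : 0 ≤ ‖η‖ ^ δ := Real.rpow_nonneg hb.le δ
  have hcoord : |(ξ + η) ⟨0, hd⟩| ≤ |ξ ⟨0, hd⟩| + |η ⟨0, hd⟩| := abs_add_le _ _
  have hnum : |(ξ + η) ⟨0, hd⟩| + ‖ξ + η‖ ^ δ ≤
      2 ^ δ * ((|ξ ⟨0, hd⟩| + ‖ξ‖ ^ δ) + (|η ⟨0, hd⟩| + ‖η‖ ^ δ)) := by
    nlinarith [mul_nonneg (sub_nonneg.2 hδ1) (abs_nonneg (ξ ⟨0, hd⟩)),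
      mul_nonneg (sub_nonneg.2 hδ1) (abs_nonneg (η ⟨0, hd⟩)),
      mul_nonneg (sub_nonneg.2 hδ1) hBδ]
  have hinv : 1 / ‖ξ + η‖ ^ r ≤ 2 ^ r / ‖ξ‖ ^ r := by
    rw [div_le_div_iff₀ hS hA]
    linarith
  unfold muW
  calc (|(ξ + η) ⟨0, hd⟩| + ‖ξ + η‖ ^ δ) / ‖ξ + η‖ ^ r
      = (|(ξ + η) ⟨0, hd⟩| + ‖ξ + η‖ ^ δ) * (1 / ‖ξ + η‖ ^ r) := by ring
    _ ≤ (2 ^ δ * ((|ξ ⟨0, hd⟩| + ‖ξ‖ ^ δ) + (|η ⟨0, hd⟩| + ‖η‖ ^ δ))) * (2 ^ r / ‖ξ‖ ^ r) := by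
      gcongr
    _ = 2 ^ δ * 2 ^ r *
        ((|ξ ⟨0, hd⟩| + ‖ξ‖ ^ δ) / ‖ξ‖ ^ r + (|η ⟨0, hd⟩| + ‖η‖ ^ δ) / ‖ξ‖ ^ r) := by ring
    _ ≤ _ := by gcongr

theorem stmt11 (d : ℕ) (hd : 0 < d) (r δ : ℝ) (hr : 0 ≤ r) (hrδ : r ≤ δ) :
    ∃ C : ℝ, 0 < C ∧ ∀ ξ η : EuclideanSpace ℝ (Fin d), ξ ≠ 0 → η ≠ 0 →
      ‖ξ‖ + ‖η‖ ≤ 3 * |‖ξ‖ - ‖η‖| →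
      muW d hd r δ (ξ + η) ≤ C * (muW d hd r δ ξ + muW d hd r δ η) := by
  refine ⟨2 ^ δ * 2 ^ r, by positivity, fun ξ η hξ hη h => ?_⟩
  have hδ : 0 ≤ δ := hr.trans hrδ
  rcases le_total ‖η‖ ‖ξ‖ with hle | hle
  · rw [abs_of_nonneg (sub_nonneg.2 hle)] at h
    exact muW_add_le_of_two_mul_norm_le d hd r δ hr hδ hξ hη (by linarith)
  · rw [abs_of_nonpos (sub_nonpos.2 hle)] at h
    rw [add_comm ξ η, add_comm (muW d hd r δ ξ)]
    exact muW_add_le_of_two_mul_norm_le d hd r δ hr hδ hη hξ (by linarith)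
end
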